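/- arXiv:1710.01266 — 2 statements merged into one kernel-verified Lean document; each statement's English description precedes it below -/
import Mathlib

section
/- Let m, d ≥ 1, let ω ∈ ℝ^d satisfy ω·ν ≠ 0 for every nonzero ν ∈ ℤ^d, let Γ be a symmetric positive definite real m×m matrix, V : ℝ^m → ℝ real analytic with g = ∇V, f : ℝ^d → ℝ^m (2πℤ)^d-periodic and real analytic with mean f₀, and let c ∈ ℝ^m satisfy g(c) = f₀ with the Hessian of V at c positive definite. Then there exist ε₀ > 0, a continuous function ζ : [0, ε₀) → ℝ^m with ζ(0) = 0, and for each ε ∈ (0, ε₀) a real analytic, (2πℤ)^d-periodic, zero-mean function u_ε : ℝ^d → ℝ^m, such that x(t) := c + ζ(ε) + u_ε(ωt) satisfies ε x''(t) + Γ x'(t) + ε g(x(t)) = ε f(ωt) for all t ∈ ℝ, and sup_{t∈ℝ} |x(t) − c| → 0 as ε → 0⁺. -/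
open scoped Real
open Filter

noncomputable section

/-- The mean of a `(2πℤ)^d`-periodic function over the fundamental box `[0,2π]^d`. -/
def boxMean (d m : ℕ) (F : (Fin d → ℝ) → (Fin m → ℝ)) : Fin m → ℝ :=
  ((2 * π)⁻¹ ^ d) • ∫ ψ in Set.univ.pi fun _ : Fin d => Set.Icc (0 : ℝ) (2 * π), F ψ

/-- `(2πℤ)^d`-periodicity. -/
def IsPeriodic2pi (d m : ℕ) (F : (Fin d → ℝ) → (Fin m → ℝ)) : Prop :=
  ∀ (ψ : Fin d → ℝ) (k : Fin d → ℤ), F (fun j => ψ j + 2 * π * k j) = F ψ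

/-- The Hessian matrix of `V : ℝ^m → ℝ` at the point `c`. -/
def hessianMatrix (m : ℕ) (V : (Fin m → ℝ) → ℝ) (c : Fin m → ℝ) :
    Matrix (Fin m) (Fin m) ℝ :=
  Matrix.of fun i j => iteratedFDeriv ℝ 2 V c ![Pi.single i 1, Pi.single j 1]

section Helpers
open scoped BoundedContinuousFunction

section Resolvent
set_option linter.unusedSectionVars false
open MeasureTheory Set

variable {F : Type*} [NormedAddCommGroup F] [NormedSpace ℝ F]

lemma res_integrable {b : ℝ} (hb : 0 < b) (h : ℝ →ᵇ F) (t : ℝ) :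
    IntegrableOn (fun s => Real.exp (b * s) • h s) (Iic t) := by
  have h1 := (integrableOn_exp_mul_Iic hb t).mul_const ‖h‖
  refine Integrable.mono' h1 ?_ ?_
  · exact (Continuous.aestronglyMeasurable (by fun_prop))
  · refine Eventually.of_forall fun s => ?_
    rw [norm_smul, Real.norm_eq_abs, abs_of_pos (Real.exp_pos _)]
    gcongr
    exact h.norm_coe_le_norm s

def resFun (b : ℝ) (h : ℝ → F) (t : ℝ) : F :=
  Real.exp (-(b * t)) • ∫ s in Iic t, Real.exp (b * s) • h s

lemma resFun_norm {b : ℝ} (hb : 0 < b) (h : ℝ →ᵇ F) (t : ℝ) :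
    ‖resFun b h t‖ ≤ 1 / b * ‖h‖ := by
  unfold resFun
  rw [norm_smul, Real.norm_eq_abs, abs_of_pos (Real.exp_pos _)]
  have h2 : ‖∫ s in Iic t, Real.exp (b * s) • h s‖ ≤ ∫ s in Iic t, Real.exp (b * s) * ‖h‖ := by
    refine norm_integral_le_of_norm_le ((integrableOn_exp_mul_Iic hb t).mul_const ‖h‖) ?_
    refine Eventually.of_forall fun s => ?_
    rw [norm_smul, Real.norm_eq_abs, abs_of_pos (Real.exp_pos _)]
    gcongr
    exact h.norm_coe_le_norm s
  rw [integral_mul_const, integral_exp_mul_Iic hb] at h2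
  calc _ ≤ Real.exp (-(b * t)) * (Real.exp (b * t) / b * ‖h‖) := by gcongr
    _ = (Real.exp (-(b * t)) * Real.exp (b * t)) * (1 / b * ‖h‖) := by ring
    _ = _ := by rw [← Real.exp_add]; simp

lemma resFun_deriv [CompleteSpace F] {b : ℝ} (hb : 0 < b) (h : ℝ →ᵇ F) (t : ℝ) :
    HasDerivAt (resFun b h) (h t - b • resFun b h t) t := by
  have hc : Continuous (fun s => Real.exp (b * s) • h s) := by fun_prop
  have e : ∀ t, ∫ s in Iic t, Real.exp (b * s) • h s =
      (∫ s in Iic (0:ℝ), Real.exp (b * s) • h s) + ∫ s in (0:ℝ)..t, Real.exp (b * s) • h s := by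
    intro t
    rw [← intervalIntegral.integral_Iic_sub_Iic (res_integrable hb h 0) (res_integrable hb h t)]
    abel
  have d1 : HasDerivAt (fun t => ∫ s in Iic t, Real.exp (b * s) • h s)
      (Real.exp (b * t) • h t) t := by
    rw [funext e]
    exact (intervalIntegral.integral_hasDerivAt_right (hc.intervalIntegrable _ _)
      hc.stronglyMeasurable.stronglyMeasurableAtFilter hc.continuousAt).const_add _
  have d2 : HasDerivAt (fun t => Real.exp (-(b * t))) (Real.exp (-(b * t)) * (-b)) t := by
    have := ((hasDerivAt_id t).const_mul b).neg.exp
    simpa using this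
  have := d2.smul d1
  unfold resFun
  refine this.congr_deriv ?_
  rw [smul_smul, ← Real.exp_add, smul_smul]
  simp [sub_eq_add_neg, mul_comm b, neg_smul]

lemma res_unique {b : ℝ} (hb : 0 < b) (y : ℝ →ᵇ F)
    (hy : ∀ t, HasDerivAt y (-(b • y t)) t) : y = 0 := by
  have hd : ∀ t, HasDerivAt (fun t => Real.exp (b * t) • y t) 0 t := by
    intro t
    have d2 : HasDerivAt (fun t => Real.exp (b * t)) (Real.exp (b * t) * b) t := by
      have := ((hasDerivAt_id t).const_mul b).exp
      simpa using this
    refine (d2.smul (hy t)).congr_deriv ?_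
    simp [smul_smul]
  have hconst : ∀ s t, Real.exp (b * s) • y s = Real.exp (b * t) • y t := fun s t =>
    is_const_of_deriv_eq_zero (fun t => (hd t).differentiableAt) (fun t => (hd t).deriv) s t
  ext t
  have hlim : Tendsto (fun s => Real.exp (b * s) * ‖y‖) atBot (nhds 0) := by
    have : Tendsto (fun s => Real.exp (b * s)) atBot (nhds 0) :=
      Real.tendsto_exp_atBot.comp (tendsto_id.const_mul_atBot hb)
    simpa using this.mul_const ‖y‖
  have hle : ‖Real.exp (b * t) • y t‖ ≤ 0 := by
    refine ge_of_tendsto' hlim fun s => ?_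
    rw [hconst t s, norm_smul, Real.norm_eq_abs, abs_of_pos (Real.exp_pos _)]
    gcongr
    exact y.norm_coe_le_norm s
  have := norm_le_zero_iff.1 hle
  simpa [(Real.exp_pos _).ne'] using this

variable [CompleteSpace F]

lemma res_unique' {b : ℝ} (hb : 0 < b) (y z h : ℝ →ᵇ F)
    (hy : ∀ t, HasDerivAt y (h t - b • y t) t) (hz : ∀ t, HasDerivAt z (h t - b • z t) t) :
    y = z := by
  have := res_unique hb (y - z) (fun t => by
    have := (hy t).sub (hz t)
    refine this.congr_deriv ?_
    simp [smul_sub])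
  exact sub_eq_zero.1 this

lemma exists_res {b : ℝ} (hb : 0 < b) : ∃ R : (ℝ →ᵇ F) →L[ℝ] (ℝ →ᵇ F),
    ‖R‖ ≤ 1 / b ∧ ∀ h t, HasDerivAt (R h) (h t - b • R h t) t := by
  have hcont : ∀ h : ℝ →ᵇ F, Continuous (resFun b h) := fun h =>
    continuous_iff_continuousAt.2 fun t => (resFun_deriv hb h t).continuousAt
  let R0 : (ℝ →ᵇ F) → (ℝ →ᵇ F) := fun h =>
    BoundedContinuousFunction.ofNormedAddCommGroup (resFun b h) (hcont h) _ (resFun_norm hb h)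
  have hR0 : ∀ h t, HasDerivAt (R0 h) (h t - b • R0 h t) t := fun h t => resFun_deriv hb h t
  let L : (ℝ →ᵇ F) →ₗ[ℝ] (ℝ →ᵇ F) :=
    { toFun := R0
      map_add' := fun x y => by
        refine res_unique' hb _ _ (x + y) (hR0 _) fun t => ?_
        refine ((hR0 x t).add (hR0 y t)).congr_deriv ?_
        simp; abel
      map_smul' := fun c x => by
        refine res_unique' hb _ _ (c • x) (hR0 _) fun t => ?_
        refine ((hR0 x t).const_smul c).congr_deriv ?_
        simp [smul_sub, smul_comm b c] }
  refine ⟨L.mkContinuous (1 / b) fun h => ?_, ?_, hR0⟩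
  · exact BoundedContinuousFunction.norm_ofNormedAddCommGroup_le _ (by positivity) (resFun_norm hb h)
  · exact LinearMap.mkContinuous_norm_le _ (by positivity) _

/-- Resolvent of `d/dt + b`. -/
def res (F : Type*) [NormedAddCommGroup F] [NormedSpace ℝ F] [CompleteSpace F] (b : ℝ) :
    (ℝ →ᵇ F) →L[ℝ] (ℝ →ᵇ F) :=
  if hb : 0 < b then (exists_res hb).choose else 0

lemma res_norm {b : ℝ} (hb : 0 < b) : ‖res F b‖ ≤ 1 / b := by
  rw [res, dif_pos hb]; exact (exists_res hb).choose_spec.1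

lemma res_deriv {b : ℝ} (hb : 0 < b) (h : ℝ →ᵇ F) (t : ℝ) :
    HasDerivAt (res F b h) (h t - b • res F b h t) t := by
  rw [res, dif_pos hb]; exact (exists_res hb).choose_spec.2 h t

lemma res_eq {b : ℝ} (hb : 0 < b) (y h : ℝ →ᵇ F)
    (hy : ∀ t, HasDerivAt y (h t - b • y t) t) : res F b h = y :=
  res_unique' hb _ _ h (res_deriv hb h) hy

/-- translation -/
def tr (F : Type*) [NormedAddCommGroup F] [NormedSpace ℝ F] (s : ℝ) (h : ℝ →ᵇ F) : ℝ →ᵇ F :=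
  h.compContinuous ⟨fun t => t + s, by fun_prop⟩

@[simp] lemma tr_apply (s : ℝ) (h : ℝ →ᵇ F) (t : ℝ) : tr F s h t = h (t + s) := rfl

lemma tr_norm (s : ℝ) (h : ℝ →ᵇ F) : ‖tr F s h‖ ≤ ‖h‖ :=
  (BoundedContinuousFunction.norm_le (norm_nonneg _)).2 fun t => h.norm_coe_le_norm _

lemma res_tr {b : ℝ} (hb : 0 < b) (s : ℝ) (h : ℝ →ᵇ F) :
    res F b (tr F s h) = tr F s (res F b h) := by
  refine res_eq hb _ _ fun t => ?_
  exact (res_deriv hb h (t + s)).comp_add_const t s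

lemma res_sub {a b : ℝ} (ha : 0 < a) (hb : 0 < b) :
    res F a - res F b = (b - a) • (res F a).comp (res F b) := by
  ext1 h
  rw [sub_apply, sub_eq_iff_eq_add]
  refine res_eq ha _ _ fun t => ?_
  have h1 := (res_deriv ha (res F b h) t).const_smul (b - a)
  have h2 := res_deriv hb h t
  refine (h1.add h2).congr_deriv ?_
  simp
  module

lemma res_continuousOn : ContinuousOn (res F) (Ioi 0) := by
  intro b hb
  have hb : 0 < b := hb
  rw [ContinuousWithinAt, tendsto_iff_norm_sub_tendsto_zero]
  have hbd : ∀ᶠ a in nhdsWithin b (Ioi 0), ‖res F a - res F b‖ ≤ |b - a| * (1 / a * (1 / b)) := by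
    filter_upwards [self_mem_nhdsWithin] with a ha
    have ha : 0 < a := ha
    rw [res_sub ha hb, norm_smul, Real.norm_eq_abs]
    gcongr
    exact (ContinuousLinearMap.opNorm_comp_le _ _).trans
      (mul_le_mul (res_norm ha) (res_norm hb) (norm_nonneg _) (by positivity))
  refine squeeze_zero' (Eventually.of_forall fun _ => norm_nonneg _) hbd ?_
  have : ContinuousAt (fun a => |b - a| * (1 / a * (1 / b))) b := by
    fun_prop (disch := exact hb.ne')
  simpa using this.tendsto.mono_left nhdsWithin_le_nhds

/-- averaging estimate -/
lemma res_average {b : ℝ} (hb : 0 < b) (h U r : ℝ →ᵇ F)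
    (hU : ∀ t, HasDerivAt U (h t - r t) t) : ‖res F b h‖ ≤ 2 * ‖U‖ + ‖r‖ / b := by
  have e : res F b h = U - b • res F b U + res F b r := by
    refine res_eq hb _ _ fun t => ?_
    refine (((hU t).sub ((res_deriv hb U t).const_smul b)).add (res_deriv hb r t)).congr_deriv ?_
    simp
    module
  rw [e]
  have h1 : ‖res F b U‖ ≤ 1 / b * ‖U‖ := (ContinuousLinearMap.le_opNorm _ _).trans (by
    gcongr; exact res_norm hb)
  have h2 : ‖res F b r‖ ≤ 1 / b * ‖r‖ := (ContinuousLinearMap.le_opNorm _ _).trans (by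
    gcongr; exact res_norm hb)
  calc _ ≤ ‖U‖ + b * ‖res F b U‖ + ‖res F b r‖ := by
        refine (norm_add_le _ _).trans ?_
        gcongr
        refine (norm_sub_le _ _).trans ?_
        rw [norm_smul, Real.norm_eq_abs, abs_of_pos hb]
    _ ≤ ‖U‖ + b * (1 / b * ‖U‖) + 1 / b * ‖r‖ := by gcongr
    _ = _ := by field_simp; ring

end Resolvent

section Inverse

lemma exists_local_inverse {E : Type*} [NormedAddCommGroup E] [NormedSpace ℝ E] [CompleteSpace E]
    [Nontrivial E] (K : E → E) (r : ℝ) (hr : 0 < r)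
    (hK0 : K 0 = 0) (hKan : ∀ x ∈ Metric.ball (0 : E) r, AnalyticAt ℝ K x)
    (hKlip : LipschitzOnWith (1 / 2) K (Metric.ball 0 r)) :
    ∃ σ : E → E, ∀ h ∈ Metric.ball (0 : E) (r / 2),
      σ h ∈ Metric.ball (0 : E) r ∧ σ h + K (σ h) = h ∧ AnalyticAt ℝ σ h := by
  let H : E → E := fun x => x + K x
  have hap : ApproximatesLinearOn H ((ContinuousLinearEquiv.refl ℝ E : E ≃L[ℝ] E) : E →L[ℝ] E)
      (Metric.ball 0 r) (1 / 2) := by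
    rw [ApproximatesLinearOn.approximatesLinearOn_iff_lipschitzOnWith]
    convert hKlip using 1
    ext x
    simp [H]
  have hN : ‖(((ContinuousLinearEquiv.refl ℝ E).symm : E ≃L[ℝ] E) : E →L[ℝ] E)‖₊ = 1 := by
    have : (((ContinuousLinearEquiv.refl ℝ E).symm : E ≃L[ℝ] E) : E →L[ℝ] E)
      = ContinuousLinearMap.id ℝ E := rfl
    rw [this]
    exact NNReal.eq ContinuousLinearMap.norm_id
  have hc : Subsingleton E ∨ (1 / 2 : NNReal) <
      ‖(((ContinuousLinearEquiv.refl ℝ E).symm : E ≃L[ℝ] E) : E →L[ℝ] E)‖₊⁻¹ := by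
    right
    rw [hN, inv_one]
    exact NNReal.half_lt_self one_ne_zero
  let e := hap.toOpenPartialHomeomorph H (Metric.ball 0 r) hc Metric.isOpen_ball
  have hsrc : e.source = Metric.ball 0 r := rfl
  have hecoe : ∀ x, e x = x + K x := fun x => rfl
  refine ⟨e.symm, fun h hh => ?_⟩
  have htar : h ∈ e.target := by
    have hsub : Metric.closedBall (0 : E) (2 * ‖h‖) ⊆ Metric.ball 0 r := by
      apply Metric.closedBall_subset_ball
      rw [mem_ball_zero_iff] at hh
      linarith
    have := hap.closedBall_subset_target hc Metric.isOpen_ball (by positivity) hsub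
    refine this ?_
    rw [hN]
    have hH0 : H 0 = 0 := by simp [H, hK0]
    rw [hH0, mem_closedBall_zero_iff]
    push_cast
    norm_num
    linarith
  have h1 : e.symm h ∈ Metric.ball (0 : E) r := e.map_target htar
  refine ⟨h1, e.right_inv htar, ?_⟩
  have hKd : ‖fderiv ℝ K (e.symm h)‖ < 1 := by
    have := (hKan _ h1).differentiableAt.hasFDerivAt.le_of_lipschitzOn
      (Metric.isOpen_ball.mem_nhds h1) hKlip
    refine this.trans_lt ?_
    push_cast
    norm_num
  have hfd : fderiv ℝ e (e.symm h) = 1 + fderiv ℝ K (e.symm h) := by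
    have : (⇑e) = fun x => x + K x := rfl
    rw [this]
    exact ((hasFDerivAt_id _).add (hKan _ h1).differentiableAt.hasFDerivAt).fderiv
  let un := Units.oneSub (-(fderiv ℝ K (e.symm h))) (by rwa [norm_neg])
  refine e.analyticAt_symm htar (i := ContinuousLinearEquiv.ofUnit un) ?_ ?_
  · exact analyticAt_id.add (hKan _ h1)
  · rw [hfd]
    ext x
    change _ = (un : E →L[ℝ] E) x
    simp [un]

lemma inverse_unique {E : Type*} [NormedAddCommGroup E] [NormedSpace ℝ E]
    (K : E → E) (r : ℝ) (hKlip : LipschitzOnWith (1 / 2) K (Metric.ball 0 r))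
    {x y : E} (hx : x ∈ Metric.ball 0 r) (hy : y ∈ Metric.ball 0 r) :
    ‖x - y‖ ≤ 2 * ‖(x + K x) - (y + K y)‖ := by
  have h1 := hKlip.dist_le_mul _ hx _ hy
  rw [dist_eq_norm, dist_eq_norm] at h1
  push_cast at h1
  have h2 : ‖x - y‖ ≤ ‖(x + K x) - (y + K y)‖ + ‖K x - K y‖ := by
    have : x - y = ((x + K x) - (y + K y)) - (K x - K y) := by abel
    calc ‖x - y‖ = ‖((x + K x) - (y + K y)) - (K x - K y)‖ := by rw [← this]
      _ ≤ _ := norm_sub_le _ _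
  linarith

end Inverse

section Nemytskii
variable {T V F : Type*} [TopologicalSpace T] [NormedAddCommGroup V] [NormedSpace ℝ V]
  [NormedAddCommGroup F] [NormedSpace ℝ F]

/-- pointwise application of a bounded continuous family of multilinear maps -/
def nemMul (n : ℕ) (q : T → (V [×n]→L[ℝ] F)) (hq : Continuous q) (C : ℝ) (hC : 0 ≤ C)
    (hqC : ∀ t, ‖q t‖ ≤ C) : (T →ᵇ V) [×n]→L[ℝ] (T →ᵇ F) :=
  MultilinearMap.mkContinuous
    { toFun := fun y => BoundedContinuousFunction.ofNormedAddCommGroup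
        (fun t => q t fun i => y i t)
        (by
          have h1 : Continuous fun t => ((q t, fun i => y i t) : (V [×n]→L[ℝ] F) × (Fin n → V)) := by
            fun_prop
          fun_prop)
        (C * ∏ i, ‖y i‖)
        (fun t => (ContinuousMultilinearMap.le_opNorm _ _).trans (by
          gcongr with i
          · exact hqC t
          · exact (y i).norm_coe_le_norm t))
      map_update_add' := fun y i a b => by
        ext t
        have e : ∀ z : T →ᵇ V, (fun j => (Function.update y i z) j t) =
            Function.update (fun j => y j t) i (z t) := by
          intro z
          ext j
          by_cases h : j = i
          · subst h; simp
          · simp [h]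
        simp [e]
      map_update_smul' := fun y i a b => by
        ext t
        have e : ∀ z : T →ᵇ V, (fun j => (Function.update y i z) j t) =
            Function.update (fun j => y j t) i (z t) := by
          intro z
          ext j
          by_cases h : j = i
          · subst h; simp
          · simp [h]
        simp [e] }
    C (fun y => BoundedContinuousFunction.norm_ofNormedAddCommGroup_le _ (by positivity) (fun t => (ContinuousMultilinearMap.le_opNorm _ _).trans (by
          gcongr with i
          · exact hqC t
          · exact (y i).norm_coe_le_norm t)))

lemma nemMul_apply (n : ℕ) (q : T → (V [×n]→L[ℝ] F)) (hq : Continuous q) (C : ℝ) (hC : 0 ≤ C)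
    (hqC : ∀ t, ‖q t‖ ≤ C) (y : Fin n → (T →ᵇ V)) (t : T) :
    nemMul n q hq C hC hqC y t = q t fun i => y i t := rfl

lemma nemMul_norm (n : ℕ) (q : T → (V [×n]→L[ℝ] F)) (hq : Continuous q) (C : ℝ) (hC : 0 ≤ C)
    (hqC : ∀ t, ‖q t‖ ≤ C) : ‖nemMul n q hq C hC hqC‖ ≤ C :=
  MultilinearMap.mkContinuous_norm_le _ hC _

/-- Composition operators with uniformly analytic families are analytic. -/
lemma nemytskii [CompleteSpace F] (q : (n : ℕ) → T → (V [×n]→L[ℝ] F)) (hq : ∀ n, Continuous (q n))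
    (C r : ℝ) (hC : 0 ≤ C) (hr : 0 < r) (hqC : ∀ n t, ‖q n t‖ ≤ C * r⁻¹ ^ n)
    (φ : T → V → F) (hφ : ∀ t v, ‖v‖ < r → HasSum (fun n => q n t fun _ => v) (φ t v))
    (N : (T →ᵇ V) → (T →ᵇ F)) (hN : ∀ y t, ‖y‖ < r → N y t = φ t (y t)) :
    HasFPowerSeriesOnBall N (fun n => nemMul n (q n) (hq n) (C * r⁻¹ ^ n) (by positivity) (hqC n))
      0 (ENNReal.ofReal r) := by
  refine ⟨?_, by simpa using hr, ?_⟩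
  · have hr' : ENNReal.ofReal r = ((r.toNNReal : NNReal) : ENNReal) := rfl
    rw [hr']
    refine FormalMultilinearSeries.le_radius_of_bound _ C fun n => ?_
    calc _ ≤ (C * r⁻¹ ^ n) * r ^ n := by
          gcongr
          · exact nemMul_norm _ _ _ _ _ _
          · rw [Real.coe_toNNReal _ hr.le]
      _ = C := by rw [mul_assoc, ← mul_pow, inv_mul_cancel₀ hr.ne']; simp
  · intro y hy
    have hy : ‖y‖ < r := by
      simpa [Metric.mem_eball, edist_zero_right, ← ofReal_norm, ENNReal.ofReal_lt_ofReal_iff hr] using hy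
    rw [zero_add]
    have hsum : Summable (fun n => nemMul n (q n) (hq n) (C * r⁻¹ ^ n) (by positivity) (hqC n)
        fun _ => y) := by
      have hg : Summable (fun n : ℕ => C * (r⁻¹ * ‖y‖) ^ n) := by
        refine (summable_geometric_of_lt_one (by positivity) ?_).mul_left C
        rw [inv_mul_lt_iff₀ hr]; simpa using hy
      refine Summable.of_norm_bounded hg fun n => ?_
      refine (ContinuousMultilinearMap.le_opNorm _ _).trans ?_
      rw [mul_pow, ← mul_assoc]
      gcongr
      · exact nemMul_norm _ _ _ _ _ _
      · simp
    have hs := hsum.hasSum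
    suffices hh : N y = ∑' n, nemMul n (q n) (hq n) (C * r⁻¹ ^ n) (by positivity) (hqC n)
        fun _ => y by rw [hh]; exact hs
    ext t
    have h1 := hs.map (BoundedContinuousFunction.evalCLM ℝ t) (BoundedContinuousFunction.evalCLM ℝ t).continuous
    have h2 := hφ t (y t) ((y.norm_coe_le_norm t).trans_lt hy)
    rw [hN y t hy]
    exact h2.unique h1

end Nemytskii

section Uniform
set_option linter.unusedSectionVars false
variable {V F : Type*} [NormedAddCommGroup V] [NormedSpace ℝ V]
  [NormedAddCommGroup F] [NormedSpace ℝ F] [CompleteSpace F]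

/-- uniform Taylor expansion at a point -/
def UB (f : V → F) (C r : ℝ) (θ : V) : Prop :=
  (∀ n : ℕ, ‖((n.factorial : ℝ)⁻¹ • iteratedFDeriv ℝ n f θ)‖ ≤ C * r⁻¹ ^ n) ∧
  ∀ v, ‖v‖ < r → HasSum (fun n : ℕ => ((n.factorial : ℝ)⁻¹ • iteratedFDeriv ℝ n f θ) fun _ => v)
    (f (θ + v))

lemma UB.mono {f : V → F} {C r C' r' : ℝ} {θ : V} (h : UB f C r θ) (hC : 0 ≤ C') (hCC : C ≤ C')
    (hr : 0 < r') (hrr : r' ≤ r) : UB f C' r' θ := by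
  refine ⟨fun n => (h.1 n).trans ?_, fun v hv => h.2 v (hv.trans_le hrr)⟩
  have : 0 < r := hr.trans_le hrr
  gcongr

lemma UB_local (f : V → F) (θ₀ : V) (hf : AnalyticAt ℝ f θ₀) :
    ∃ C r : ℝ, 0 ≤ C ∧ 0 < r ∧ ∀ᶠ θ in nhds θ₀, UB f C r θ := by
  obtain ⟨p, R, hp⟩ := hf
  obtain ⟨ρ, hρ0, hρ⟩ : ∃ ρ : NNReal, 0 < ρ ∧ ((ρ + ρ : NNReal) : ENNReal) < R := by
    obtain ⟨ρ, h0, h1⟩ := ENNReal.lt_iff_exists_nnreal_btwn.1 hp.r_pos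
    refine ⟨ρ / 2, by simpa using h0, by simpa using h1⟩
  have hρr : ((ρ + ρ : NNReal) : ENNReal) < p.radius := hρ.trans_le hp.r_le
  have hsum := p.changeOriginSeries_summable_aux₁ (r := ρ) (r' := ρ) (by exact_mod_cast hρr)
  set C : NNReal := ∑' s : (Σ k l : ℕ, { s : Finset (Fin (k + l)) // s.card = l }),
      ‖p (s.1 + s.2.1)‖₊ * ρ ^ s.2.1 * ρ ^ s.1 with hC
  refine ⟨C, ρ, C.2, hρ0, ?_⟩
  have hball : Metric.ball θ₀ (ρ : ℝ) ∈ nhds θ₀ := Metric.ball_mem_nhds _ hρ0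
  filter_upwards [hball] with θ hθ
  have hy : ‖θ - θ₀‖₊ < ρ := by
    rw [mem_ball_iff_norm] at hθ
    exact_mod_cast hθ
  set y := θ - θ₀ with hyd
  have hρlt : (ρ : ENNReal) < R := lt_of_le_of_lt (by
    push_cast; exact le_self_add) hρ
  have hyR : (‖y‖₊ : ENNReal) < R := lt_of_lt_of_le (by exact_mod_cast hy) hρlt.le
  have hq := hp.changeOrigin hyR
  have hθe : θ₀ + y = θ := by simp [hyd]
  rw [hθe] at hq
  have hqn : ∀ n, ‖p.changeOrigin y n‖₊ * ρ ^ n ≤ C := by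
    intro n
    have h1 := p.nnnorm_changeOrigin_le n (hyR.trans_le hp.r_le)
    have h2 := NNReal.summable_sigma.1 hsum
    have hs2 := p.changeOriginSeries_summable_aux₂ (r := ρ) (hρlt.trans_le hp.r_le) n
    have hs3 := p.changeOriginSeries_summable_aux₂ (hyR.trans_le hp.r_le) n
    calc _ ≤ (∑' s : Σ l : ℕ, { s : Finset (Fin (n + l)) // s.card = l },
            ‖p (n + s.1)‖₊ * ‖y‖₊ ^ s.1) * ρ ^ n := by gcongr
      _ ≤ (∑' s : Σ l : ℕ, { s : Finset (Fin (n + l)) // s.card = l },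
            ‖p (n + s.1)‖₊ * ρ ^ s.1) * ρ ^ n := by
          refine mul_le_mul_left ?_ _
          exact hs3.tsum_le_tsum (fun s => by gcongr) hs2
      _ = ∑' s : Σ l : ℕ, { s : Finset (Fin (n + l)) // s.card = l },
            ‖p (n + s.1)‖₊ * ρ ^ s.1 * ρ ^ n := by rw [NNReal.tsum_mul_right]
      _ ≤ ∑' k : ℕ, ∑' s : Σ l : ℕ, { s : Finset (Fin (k + l)) // s.card = l },
            ‖p (k + s.1)‖₊ * ρ ^ s.1 * ρ ^ k := h2.2.le_tsum n (fun _ _ => zero_le)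
      _ = C := (hsum.tsum_sigma' h2.1).symm
  constructor
  · intro n
    have h3 : ‖iteratedFDeriv ℝ n f θ‖ ≤ n.factorial * ‖p.changeOrigin y n‖ := by
      refine ContinuousMultilinearMap.opNorm_le_bound (by positivity) fun v => ?_
      rw [hq.iteratedFDeriv_eq_sum_of_completeSpace]
      refine (norm_sum_le _ _).trans ?_
      have : ∀ σ : Equiv.Perm (Fin n), ‖p.changeOrigin y n fun i => v (σ i)‖ ≤
          ‖p.changeOrigin y n‖ * ∏ i, ‖v i‖ := by
        intro σ
        refine (ContinuousMultilinearMap.le_opNorm _ _).trans ?_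
        rw [Equiv.prod_comp σ (fun i => ‖v i‖)]
      refine (Finset.sum_le_sum fun σ _ => this σ).trans ?_
      simp [Fintype.card_perm, mul_assoc]
    have h4 : ‖p.changeOrigin y n‖ * (ρ : ℝ) ^ n ≤ C := by exact_mod_cast hqn n
    have hρ' : (0 : ℝ) < ρ := hρ0
    rw [norm_smul, norm_inv, Real.norm_natCast, inv_pow, ← div_eq_mul_inv, le_div_iff₀ (by positivity)]
    calc _ ≤ (n.factorial : ℝ)⁻¹ * (n.factorial * ‖p.changeOrigin y n‖) * (ρ : ℝ) ^ n := by gcongr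
      _ = ‖p.changeOrigin y n‖ * (ρ : ℝ) ^ n := by
        have : (n.factorial : ℝ) ≠ 0 := by positivity
        field_simp
      _ ≤ C := h4
  · intro v hv
    have := hq.hasSum_iteratedFDeriv (y := v) (by
      rw [Metric.mem_eball, edist_zero_right]
      have : (‖v‖₊ : ENNReal) < ρ := by exact_mod_cast hv
      refine lt_of_lt_of_le this ?_
      refine ENNReal.le_sub_of_add_le_right (by simp) ?_
      refine le_trans ?_ hρ.le
      push_cast
      gcongr)
    exact this

lemma UB_compact (f : V → F) (hf : AnalyticOnNhd ℝ f Set.univ) {K : Set V} (hK : IsCompact K) :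
    ∃ C r : ℝ, 0 ≤ C ∧ 0 < r ∧ ∀ θ ∈ K, UB f C r θ := by
  refine hK.induction_on (p := fun s => ∃ C r : ℝ, 0 ≤ C ∧ 0 < r ∧ ∀ θ ∈ s, UB f C r θ)
    ⟨0, 1, le_rfl, one_pos, by simp⟩ ?_ ?_ ?_
  · rintro s t hst ⟨C, r, hC, hr, h⟩
    exact ⟨C, r, hC, hr, fun θ hθ => h θ (hst hθ)⟩
  · rintro s t ⟨C, r, hC, hr, h⟩ ⟨C', r', hC', hr', h'⟩
    refine ⟨max C C', min r r', le_max_of_le_left hC, lt_min hr hr', ?_⟩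
    rintro θ (hθ | hθ)
    · exact (h θ hθ).mono (le_max_of_le_left hC) (le_max_left _ _) (lt_min hr hr') (min_le_left _ _)
    · exact (h' θ hθ).mono (le_max_of_le_left hC) (le_max_right _ _) (lt_min hr hr')
        (min_le_right _ _)
  · intro x _
    obtain ⟨C, r, hC, hr, h⟩ := UB_local f x (hf x trivial)
    exact ⟨{θ | UB f C r θ}, mem_nhdsWithin_of_mem_nhds h, C, r, hC, hr, fun θ hθ => hθ⟩

/-- constant functions as a continuous linear map -/
def constCLM (V : Type*) [NormedAddCommGroup V] [NormedSpace ℝ V] : V →L[ℝ] (ℝ →ᵇ V) :=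
  LinearMap.mkContinuous
    { toFun := fun v => BoundedContinuousFunction.const ℝ v
      map_add' := fun _ _ => rfl
      map_smul' := fun _ _ => rfl } 1 (fun v => by
        rw [one_mul]
        exact (BoundedContinuousFunction.norm_le (norm_nonneg _)).2 fun _ => le_rfl)

lemma constCLM_apply (v : V) (t : ℝ) : constCLM V v t = v := rfl

/-- The orbit of a bounded continuous function. -/
def orb (f : V → F) (hf : Continuous f) (M : ℝ) (hM : ∀ x, ‖f x‖ ≤ M) (w : V) (ψ : V) : ℝ →ᵇ F :=
  BoundedContinuousFunction.ofNormedAddCommGroup (fun t : ℝ => f (ψ + t • w)) (by fun_prop) M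
    (fun t => hM _)

lemma orb_apply (f : V → F) (hf : Continuous f) (M : ℝ) (hM : ∀ x, ‖f x‖ ≤ M) (w : V) (ψ : V)
    (t : ℝ) : orb f hf M hM w ψ t = f (ψ + t • w) := rfl

lemma orb_analytic (f : V → F) (hf : Continuous f) (M : ℝ) (hM : ∀ x, ‖f x‖ ≤ M) (w : V)
    (hfan : AnalyticOnNhd ℝ f Set.univ)
    (C r : ℝ) (hC : 0 ≤ C) (hr : 0 < r) (hUB : ∀ θ, UB f C r θ) (ψ₀ : V) :
    AnalyticAt ℝ (orb f hf M hM w) ψ₀ := by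
  let N : (ℝ →ᵇ V) → (ℝ →ᵇ F) := fun y =>
    BoundedContinuousFunction.ofNormedAddCommGroup (fun t : ℝ => f (ψ₀ + t • w + y t))
      (by fun_prop) M (fun t => hM _)
  have hcd : ContDiff ℝ ⊤ f := (hfan.contDiff)
  have hcont : ∀ n : ℕ, Continuous fun θ => ((n.factorial : ℝ)⁻¹ • iteratedFDeriv ℝ n f θ) := by
    intro n
    have h1 : Continuous (iteratedFDeriv ℝ n f) :=
      hcd.continuous_iteratedFDeriv (m := n) (by exact_mod_cast le_top)
    exact h1.const_smul ((n.factorial : ℝ)⁻¹)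
  have h := nemytskii (T := ℝ) (V := V) (F := F)
    (fun n t => ((n.factorial : ℝ)⁻¹ • iteratedFDeriv ℝ n f (ψ₀ + t • w)))
    (fun n => (hcont n).comp (by fun_prop : Continuous fun t : ℝ => ψ₀ + t • w)) C r hC hr
    (fun n t => (hUB _).1 n) (fun t v => f (ψ₀ + t • w + v)) (fun t v hv => (hUB _).2 v hv) N
    (fun y t _ => rfl)
  have h0 : AnalyticAt ℝ N ((fun ψ => constCLM V (ψ - ψ₀)) ψ₀) := by
    simpa using h.analyticAt
  have h1 : AnalyticAt ℝ (fun ψ => constCLM V (ψ - ψ₀)) ψ₀ :=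
    ((constCLM V).analyticAt _).comp (analyticAt_id.sub analyticAt_const)
  have h2 := AnalyticAt.comp (g := N) (f := fun ψ => constCLM V (ψ - ψ₀)) h0 h1
  convert h2 using 1
  ext ψ t
  simp only [orb_apply, Function.comp]
  change _ = f (ψ₀ + t • w + (ψ - ψ₀))
  congr 1
  abel

end Uniform

section Periodic
open MeasureTheory

/-- The fundamental box. -/
abbrev bx (d : ℕ) : Set (Fin d → ℝ) := Set.univ.pi fun _ : Fin d => Set.Icc (0 : ℝ) (2 * π)

lemma bx_compact (d : ℕ) : IsCompact (bx d) := isCompact_univ_pi fun _ => isCompact_Icc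

lemma bx_volume (d : ℕ) : (volume : Measure (Fin d → ℝ)).real (bx d) = (2 * π) ^ d := by
  rw [Measure.real, volume_pi_pi]
  simp [Real.volume_Icc, ENNReal.toReal_pow, Real.pi_pos.le]

lemma exists_shift {d : ℕ} (θ : Fin d → ℝ) :
    ∃ k : Fin d → ℤ, (fun j => θ j + 2 * π * k j) ∈ bx d := by
  have h : ∀ j, ∃ k : ℤ, θ j + 2 * π * k ∈ Set.Icc (0 : ℝ) (2 * π) := by
    intro j
    obtain ⟨k, hk, -⟩ := existsUnique_add_zsmul_mem_Ico Real.two_pi_pos (θ j) 0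
    refine ⟨k, ?_⟩
    simp only [zsmul_eq_mul, zero_add, Set.mem_Ico] at hk
    rw [mul_comm (2 * π)]
    exact ⟨hk.1, hk.2.le⟩
  choose k hk using h
  exact ⟨k, fun j _ => hk j⟩

lemma periodic_bounded {d m : ℕ} (f : (Fin d → ℝ) → (Fin m → ℝ)) (hf : IsPeriodic2pi d m f)
    (hc : Continuous f) : ∃ M, ∀ x, ‖f x‖ ≤ M := by
  obtain ⟨M, hM⟩ := (bx_compact d).exists_bound_of_continuousOn hc.continuousOn
  refine ⟨M, fun x => ?_⟩
  obtain ⟨k, hk⟩ := exists_shift x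
  rw [← hf x k]
  exact hM _ hk

lemma periodic_UB {d m : ℕ} (f : (Fin d → ℝ) → (Fin m → ℝ)) (hf : IsPeriodic2pi d m f)
    (hfan : AnalyticOnNhd ℝ f Set.univ) :
    ∃ C r : ℝ, 0 ≤ C ∧ 0 < r ∧ ∀ θ, UB f C r θ := by
  obtain ⟨C, r, hC, hr, h⟩ := UB_compact f hfan (bx_compact d)
  refine ⟨C, r, hC, hr, fun θ => ?_⟩
  obtain ⟨k, hk⟩ := exists_shift θ
  have h1 := h _ hk
  have e : (fun j => θ j + 2 * π * k j) = θ + fun j => 2 * π * (k j : ℝ) := rfl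
  have e2 : (fun x => f (x + fun j => 2 * π * (k j : ℝ))) = f := funext fun x => hf x k
  rw [e] at h1
  have e3 : ∀ n, iteratedFDeriv ℝ n f (θ + fun j => 2 * π * (k j : ℝ)) = iteratedFDeriv ℝ n f θ := by
    intro n
    rw [← iteratedFDeriv_comp_add_right, e2]
  refine ⟨fun n => ?_, fun v hv => ?_⟩
  · have := h1.1 n
    rwa [e3] at this
  · have := h1.2 v hv
    simp only [e3] at this
    have e4 : f (θ + (fun j => 2 * π * (k j : ℝ)) + v) = f (θ + v) := by
      rw [add_right_comm]; exact hf (θ + v) k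
    rwa [e4] at this

/-- exponentials -/
def ex {d : ℕ} (ν : Fin d → ℤ) (ψ : Fin d → ℝ) : ℂ :=
  Complex.exp (Complex.I * ((∑ j, ψ j * (ν j : ℝ) : ℝ) : ℂ))

lemma ex_norm {d : ℕ} (ν : Fin d → ℤ) (ψ : Fin d → ℝ) : ‖ex ν ψ‖ = 1 := by
  rw [ex, mul_comm, Complex.norm_exp_ofReal_mul_I]

lemma ex_continuous {d : ℕ} (ν : Fin d → ℤ) : Continuous (ex ν) := by
  unfold ex; fun_prop

lemma ex_integral {d : ℕ} (ν : Fin d → ℤ) (hν : ν ≠ 0) : ∫ ψ in bx d, ex ν ψ = 0 := by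
  obtain ⟨j, hj⟩ := Function.ne_iff.1 hν
  have e1 : ∀ ψ : Fin d → ℝ, ex ν ψ = ∏ i, Complex.exp (Complex.I * (ν i : ℂ) * (ψ i : ℂ)) := by
    intro ψ
    rw [ex, ← Complex.exp_sum]
    congr 1
    push_cast
    rw [Finset.mul_sum]
    exact Finset.sum_congr rfl fun i _ => by ring
  simp_rw [e1]
  rw [volume_pi, Measure.restrict_pi_pi,
    integral_fintype_prod_eq_prod (f := fun i (x : ℝ) => Complex.exp (Complex.I * (ν i : ℂ) * (x : ℂ)))]
  refine Finset.prod_eq_zero (Finset.mem_univ j) ?_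
  rw [integral_Icc_eq_integral_Ioc, ← intervalIntegral.integral_of_le Real.two_pi_pos.le]
  have hne : Complex.I * (ν j : ℂ) ≠ 0 := by
    simpa using hj
  rw [integral_exp_mul_complex hne]
  have : Complex.exp (Complex.I * (ν j : ℂ) * ((2 * π : ℝ) : ℂ)) = 1 := by
    rw [Complex.exp_eq_one_iff]
    exact ⟨ν j, by push_cast; ring⟩
  rw [this]
  simp

/-- projection to the torus -/
def prj {d : ℕ} (ψ : Fin d → ℝ) : UnitAddTorus (Fin d) :=
  fun j => ((ψ j / (2 * π) : ℝ) : UnitAddCircle)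

lemma mFourier_prj {d : ℕ} (ν : Fin d → ℤ) (ψ : Fin d → ℝ) :
    UnitAddTorus.mFourier ν (prj ψ) = ex ν ψ := by
  simp only [UnitAddTorus.mFourier, prj, ContinuousMap.coe_mk, fourier_coe_apply]
  rw [ex, ← Complex.exp_sum]
  congr 1
  push_cast
  rw [Finset.mul_sum]
  refine Finset.sum_congr rfl fun i _ => ?_
  have : (π : ℂ) ≠ 0 := by exact_mod_cast Real.pi_ne_zero
  field_simp

lemma prj_quot (d : ℕ) : Topology.IsQuotientMap (prj (d := d)) := by
  have h1 : IsOpenQuotientMap (fun x : ℝ => (x : UnitAddCircle)) :=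
    QuotientAddGroup.isOpenQuotientMap_mk
  have h2 : IsOpenQuotientMap (Pi.map fun (_ : Fin d) (x : ℝ) => (x : UnitAddCircle)) :=
    IsOpenQuotientMap.piMap fun _ => h1
  have hp : (2 * π)⁻¹ ≠ 0 := by positivity
  have h3 := h2.comp (Homeomorph.smulOfNeZero (α := Fin d → ℝ) ((2 * π)⁻¹) hp).isOpenQuotientMap
  have : prj (d := d) = (Pi.map fun (_ : Fin d) (x : ℝ) => (x : UnitAddCircle)) ∘
      (Homeomorph.smulOfNeZero (α := Fin d → ℝ) ((2 * π)⁻¹) hp) := by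
    ext ψ j
    simp [prj, Pi.map, div_eq_inv_mul]
  rw [this]
  exact h3.isQuotientMap

lemma prj_eq {d : ℕ} {x y : Fin d → ℝ} (h : prj x = prj y) :
    ∃ k : Fin d → ℤ, y = fun j => x j + 2 * π * k j := by
  have : ∀ j, ∃ k : ℤ, y j = x j + 2 * π * k := by
    intro j
    have hj := congrFun h j
    simp only [prj] at hj
    rw [eq_comm, ← sub_eq_zero, ← AddCircle.coe_sub, AddCircle.coe_eq_zero_iff] at hj
    obtain ⟨n, hn⟩ := hj
    refine ⟨n, ?_⟩
    have hp : (π : ℝ) ≠ 0 := Real.pi_ne_zero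
    simp only [zsmul_eq_mul, mul_one] at hn
    rw [hn]
    field_simp
    ring
  choose k hk using this
  exact ⟨k, funext hk⟩

end Periodic

section Averaging
open MeasureTheory

/-- averaging of trigonometric polynomials -/
def TP {d : ℕ} (ω : Fin d → ℝ) (P : C(UnitAddTorus (Fin d), ℂ)) : Prop :=
  ∃ (a : ℂ) (U : (Fin d → ℝ) → ℂ) (M : ℝ), (∀ ψ, ‖U ψ‖ ≤ M) ∧
    (∀ (ψ : Fin d → ℝ) (t : ℝ),
      HasDerivAt (fun s : ℝ => U (ψ + s • ω)) (P (prj (ψ + t • ω)) - a) t) ∧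
    ∫ ψ in bx d, P (prj ψ) = ((2 * π) ^ d : ℝ) * a

lemma prj_continuous (d : ℕ) : Continuous (prj (d := d)) := (prj_quot d).continuous

lemma int_prj {d : ℕ} (P : C(UnitAddTorus (Fin d), ℂ)) :
    IntegrableOn (fun ψ => P (prj ψ)) (bx d) :=
  (P.continuous.comp (prj_continuous d)).continuousOn.integrableOn_compact (bx_compact d)

lemma ex_deriv {d : ℕ} (ω : Fin d → ℝ) (ν : Fin d → ℤ) (ψ : Fin d → ℝ) (t : ℝ) :
    HasDerivAt (fun s : ℝ => ex ν (ψ + s • ω))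
      (Complex.I * ((∑ j, ω j * (ν j : ℝ) : ℝ) : ℂ) * ex ν (ψ + t • ω)) t := by
  have e : ∀ s : ℝ, ∑ j, (ψ + s • ω) j * (ν j : ℝ) =
      ∑ j, ψ j * (ν j : ℝ) + s * ∑ j, ω j * (ν j : ℝ) := by
    intro s
    rw [Finset.mul_sum, ← Finset.sum_add_distrib]
    refine Finset.sum_congr rfl fun j _ => ?_
    simp only [Pi.add_apply, Pi.smul_apply, smul_eq_mul]
    ring
  simp only [ex, e]
  have h1 : HasDerivAt (fun s : ℝ => ∑ j, ψ j * (ν j : ℝ) + s * ∑ j, ω j * (ν j : ℝ))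
      (∑ j, ω j * (ν j : ℝ)) t := by
    simpa using ((hasDerivAt_id t).mul_const (∑ j, ω j * (ν j : ℝ))).const_add (∑ j, ψ j * (ν j : ℝ))
  have h2 := (h1.ofReal_comp.const_mul Complex.I).cexp
  refine h2.congr_deriv ?_
  ring

lemma TP_span {d : ℕ} (ω : Fin d → ℝ)
    (hω : ∀ ν : Fin d → ℤ, ν ≠ 0 → (∑ j, ω j * ν j) ≠ 0) (P : C(UnitAddTorus (Fin d), ℂ))
    (hP : P ∈ Submodule.span ℂ (Set.range (UnitAddTorus.mFourier (d := Fin d)))) : TP ω P := by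
  induction hP using Submodule.span_induction with
  | mem x hx =>
    obtain ⟨ν, rfl⟩ := hx
    by_cases hν : ν = 0
    · subst hν
      refine ⟨1, fun _ => 0, 0, by simp, fun ψ t => ?_, ?_⟩
      · simp only [mFourier_prj]
        simpa [ex] using hasDerivAt_const t (0 : ℂ)
      · simp only [mFourier_prj]
        have h1 : ∀ ψ : Fin d → ℝ, ex 0 ψ = 1 := fun ψ => by simp [ex]
        simp only [h1]
        rw [setIntegral_const, bx_volume, mul_one, Complex.real_smul, mul_one]
    · set z : ℂ := Complex.I * ((∑ j, ω j * (ν j : ℝ) : ℝ) : ℂ) with hz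
      have hz0 : z ≠ 0 := mul_ne_zero Complex.I_ne_zero (by exact_mod_cast hω ν hν)
      refine ⟨0, fun ψ => z⁻¹ * ex ν ψ, ‖z⁻¹‖, fun ψ => by simp [ex_norm], fun ψ t => ?_, ?_⟩
      · refine ((ex_deriv ω ν ψ t).const_mul z⁻¹).congr_deriv ?_
        rw [mFourier_prj, ← hz, inv_mul_cancel_left₀ hz0, sub_zero]
      · simp only [mFourier_prj]
        rw [ex_integral ν hν, mul_zero]
  | zero => exact ⟨0, fun _ => 0, 0, by simp, fun ψ t => by simpa using hasDerivAt_const t (0 : ℂ), by simp⟩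
  | add x y _ _ hx hy =>
    obtain ⟨a, U, M, h1, h2, h3⟩ := hx
    obtain ⟨a', U', M', h1', h2', h3'⟩ := hy
    refine ⟨a + a', fun ψ => U ψ + U' ψ, M + M', fun ψ => norm_add_le_of_le (h1 ψ) (h1' ψ),
      fun ψ t => ((h2 ψ t).add (h2' ψ t)).congr_deriv ?_, ?_⟩
    · simp only [ContinuousMap.add_apply]; ring
    · simp only [ContinuousMap.add_apply]
      rw [integral_add (int_prj x) (int_prj y), h3, h3']; ring
  | smul k x _ hx =>
    obtain ⟨a, U, M, h1, h2, h3⟩ := hx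
    refine ⟨k * a, fun ψ => k * U ψ, ‖k‖ * M, fun ψ => ?_,
      fun ψ t => ((h2 ψ t).const_mul k).congr_deriv ?_, ?_⟩
    · rw [norm_mul]; exact mul_le_mul_of_nonneg_left (h1 ψ) (norm_nonneg _)
    · simp only [ContinuousMap.smul_apply, smul_eq_mul]; ring
    · simp only [ContinuousMap.smul_apply, smul_eq_mul]
      rw [integral_const_mul, h3]; ring

lemma averaging_scalar {d : ℕ} (ω : Fin d → ℝ)
    (hω : ∀ ν : Fin d → ℤ, ν ≠ 0 → (∑ j, ω j * ν j) ≠ 0) (f : (Fin d → ℝ) → ℝ)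
    (hf : Continuous f) (hper : ∀ (ψ : Fin d → ℝ) (k : Fin d → ℤ), f (fun j => ψ j + 2 * π * k j) = f ψ)
    (h0 : ∫ ψ in bx d, f ψ = 0) (δ : ℝ) (hδ : 0 < δ) :
    ∃ M : ℝ, ∀ ψ : Fin d → ℝ, ∃ U r : ℝ → ℝ, Continuous r ∧ (∀ t, |U t| ≤ M) ∧ (∀ t, |r t| ≤ δ) ∧
      ∀ t, HasDerivAt U (f (ψ + t • ω) - r t) t := by
  let f1 : C(Fin d → ℝ, ℂ) := ⟨fun ψ => (f ψ : ℂ), by fun_prop⟩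
  have hq := prj_quot d
  let p1 : C(Fin d → ℝ, UnitAddTorus (Fin d)) := ⟨prj, prj_continuous d⟩
  have hq1 : Topology.IsQuotientMap p1 := hq
  have hfac : ∀ a b, p1 a = p1 b → f1 a = f1 b := by
    intro a b hab
    obtain ⟨k, rfl⟩ := prj_eq hab
    simp only [f1, ContinuousMap.coe_mk]
    rw [hper]
  let f2 : C(UnitAddTorus (Fin d), ℂ) := hq1.lift f1 hfac
  have hf2 : ∀ ψ, f2 (prj ψ) = (f ψ : ℂ) := by
    intro ψ
    have := hq1.lift_comp f1 hfac
    exact DFunLike.congr_fun this ψ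
  have hcl : f2 ∈ (Submodule.span ℂ (Set.range (UnitAddTorus.mFourier (d := Fin d)))).topologicalClosure := by
    rw [UnitAddTorus.span_mFourier_closure_eq_top]; trivial
  obtain ⟨P, hP, hPd⟩ := Metric.mem_closure_iff.1 hcl (δ / 2) (by positivity)
  obtain ⟨a, U, M, h1, h2, h3⟩ := TP_span ω hω P hP
  have hPn : ∀ ψ, ‖(f ψ : ℂ) - P (prj ψ)‖ ≤ δ / 2 := by
    intro ψ
    rw [← hf2, ← dist_eq_norm]
    exact (ContinuousMap.dist_apply_le_dist _).trans hPd.le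
  have ha : ‖a‖ ≤ δ / 2 := by
    have hi : ∫ ψ in bx d, ((f ψ : ℂ) - P (prj ψ)) = - (((2 * π) ^ d : ℝ) * a) := by
      rw [integral_sub _ (int_prj P), h3, integral_complex_ofReal, h0]
      · simp
      · exact (Complex.continuous_ofReal.comp hf).continuousOn.integrableOn_compact (bx_compact d)
    have hn := norm_setIntegral_le_of_norm_le_const (μ := volume) (bx_compact d).measure_lt_top
      (fun ψ _ => hPn ψ)
    rw [hi, bx_volume, norm_neg, norm_mul, Complex.norm_real, Real.norm_of_nonneg (by positivity),
      mul_comm (δ / 2)] at hn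
    exact le_of_mul_le_mul_left hn (by positivity)
  refine ⟨M, fun ψ => ⟨fun t => (U (ψ + t • ω)).re,
    fun t => ((f (ψ + t • ω) : ℂ) - P (prj (ψ + t • ω)) + a).re, ?_, fun t => ?_, fun t => ?_, fun t => ?_⟩⟩
  · have := prj_continuous d
    fun_prop
  · exact (Complex.abs_re_le_norm _).trans (h1 _)
  · refine (Complex.abs_re_le_norm _).trans ((norm_add_le _ _).trans ?_)
    linarith [hPn (ψ + t • ω)]
  · have := Complex.reCLM.hasFDerivAt.comp_hasDerivAt t (h2 ψ t)
    refine this.congr_deriv ?_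
    simp
    ring

lemma averaging {d m : ℕ} (ω : Fin d → ℝ)
    (hω : ∀ ν : Fin d → ℤ, ν ≠ 0 → (∑ j, ω j * ν j) ≠ 0) (f : (Fin d → ℝ) → (Fin m → ℝ))
    (hf : Continuous f) (hper : IsPeriodic2pi d m f)
    (h0 : ∫ ψ in bx d, f ψ = 0) (δ : ℝ) (hδ : 0 < δ) :
    ∃ M : ℝ, 0 ≤ M ∧ ∀ ψ : Fin d → ℝ, ∃ U r : ℝ →ᵇ (Fin m → ℝ), ‖U‖ ≤ M ∧ ‖r‖ ≤ δ ∧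
      ∀ t, HasDerivAt U (f (ψ + t • ω) - r t) t := by
  have hfint : IntegrableOn f (bx d) := hf.continuousOn.integrableOn_compact (bx_compact d)
  have hs : ∀ i : Fin m, ∃ M : ℝ, ∀ ψ : Fin d → ℝ, ∃ U r : ℝ → ℝ, Continuous r ∧ (∀ t, |U t| ≤ M) ∧
      (∀ t, |r t| ≤ δ) ∧ ∀ t, HasDerivAt U (f (ψ + t • ω) i - r t) t := by
    intro i
    refine averaging_scalar ω hω (fun ψ => f ψ i) (by fun_prop) (fun ψ k => by rw [hper ψ k]) ?_ δ hδ
    have := (ContinuousLinearMap.proj (R := ℝ) (φ := fun _ : Fin m => ℝ) i).integral_comp_comm hfint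
    simp only [ContinuousLinearMap.proj_apply] at this
    rw [this, h0]; rfl
  choose M hM using hs
  have hMi : ∀ i, M i ≤ ∑ j, |M j| := fun i =>
    (le_abs_self _).trans (Finset.single_le_sum (f := fun j => |M j|) (fun j _ => abs_nonneg _) (Finset.mem_univ i))
  have hM0 : 0 ≤ ∑ j, |M j| := Finset.sum_nonneg fun j _ => abs_nonneg _
  refine ⟨∑ j, |M j|, hM0, fun ψ => ?_⟩
  have := fun i => hM i ψ
  choose U r hr hU hrd hd using this
  have hdU : ∀ t, HasDerivAt (fun t i => U i t) (f (ψ + t • ω) - fun i => r i t) t := fun t =>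
    hasDerivAt_pi.2 fun i => hd i t
  have hUn : ∀ t, ‖(fun i => U i t : Fin m → ℝ)‖ ≤ ∑ j, |M j| := fun t =>
    (pi_norm_le_iff_of_nonneg hM0).2 fun i => (hU i t).trans (hMi i)
  have hrn : ∀ t, ‖(fun i => r i t : Fin m → ℝ)‖ ≤ δ := fun t =>
    (pi_norm_le_iff_of_nonneg hδ.le).2 fun i => hrd i t
  refine ⟨BoundedContinuousFunction.ofNormedAddCommGroup (fun t i => U i t)
      (continuous_iff_continuousAt.2 fun t => (hdU t).continuousAt) _ hUn,
    BoundedContinuousFunction.ofNormedAddCommGroup (fun t i => r i t) (continuous_pi hr) _ hrn,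
    (BoundedContinuousFunction.norm_le hM0).2 hUn, (BoundedContinuousFunction.norm_le hδ.le).2 hrn, hdU⟩

end Averaging

section LinAlg
open Matrix

lemma posDef_diag {m : ℕ} {A : Matrix (Fin m) (Fin m) ℝ} (hA : A.PosDef) :
    ∃ (U : Matrix (Fin m) (Fin m) ℝ) (D : Fin m → ℝ), U * Uᵀ = 1 ∧ Uᵀ * U = 1 ∧ (∀ i, 0 < D i) ∧
      A = U * diagonal D * Uᵀ := by
  refine ⟨hA.1.eigenvectorUnitary, hA.1.eigenvalues, ?_, ?_, hA.eigenvalues_pos, ?_⟩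
  · have := Unitary.coe_mul_star_self hA.1.eigenvectorUnitary
    rwa [Unitary.coe_star, star_eq_conjTranspose, conjTranspose_eq_transpose_of_trivial] at this
  · have := Unitary.coe_star_mul_self hA.1.eigenvectorUnitary
    rwa [star_eq_conjTranspose, conjTranspose_eq_transpose_of_trivial] at this
  · have := hA.1.spectral_theorem
    rw [Unitary.conjStarAlgAut_apply, star_eq_conjTranspose,
      conjTranspose_eq_transpose_of_trivial] at this
    exact this

lemma simul_diag {m : ℕ} {Γ A : Matrix (Fin m) (Fin m) ℝ} (hΓ : Γ.PosDef) (hA : A.PosDef) :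
    ∃ (P : Fin m → Matrix (Fin m) (Fin m) ℝ) (b : Fin m → ℝ), (∀ i, 0 < b i) ∧ ∑ i, P i = 1 ∧
      ∀ i, (Γ⁻¹ * A) * P i = b i • P i := by
  obtain ⟨U, D, hU1, hU2, hD, rfl⟩ := posDef_diag hΓ
  set W := U * diagonal (fun i => (√(D i))⁻¹) with hW
  set N := diagonal (fun i => √(D i)) * Uᵀ with hN
  have hs : ∀ i, √(D i) ≠ 0 := fun i => (Real.sqrt_pos.2 (hD i)).ne'
  have hWN : W * N = 1 := by
    rw [hW, hN, Matrix.mul_assoc, ← Matrix.mul_assoc (diagonal _), diagonal_mul_diagonal]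
    simp [hs, hU1]
  have hNW : N * W = 1 := mul_eq_one_comm.1 hWN
  have hG : (U * diagonal D * Uᵀ)⁻¹ = W * Wᵀ := by
    apply inv_eq_right_inv
    have e : U * diagonal D * Uᵀ = Nᵀ * N := by
      rw [hN, transpose_mul, transpose_transpose, diagonal_transpose, ← Matrix.mul_assoc, Matrix.mul_assoc U (diagonal _) (diagonal _),
        diagonal_mul_diagonal]
      congr 3
      ext i
      exact (Real.mul_self_sqrt (hD i).le).symm
    rw [e, Matrix.mul_assoc, ← Matrix.mul_assoc N, hNW, Matrix.one_mul, ← transpose_mul, hWN,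
      transpose_one]
  have hC : (Wᵀ * A * W).PosDef := by
    have := hA.conjTranspose_mul_mul_same (B := W) (fun x y hxy => by
      have := congrArg (fun z => N *ᵥ z) hxy
      simpa [mulVec_mulVec, hNW] using this)
    rwa [conjTranspose_eq_transpose_of_trivial] at this
  obtain ⟨T, b, hT1, hT2, hb, hCe⟩ := posDef_diag hC
  refine ⟨fun i => W * T * diagonal (Pi.single i 1) * (Tᵀ * N), b, hb, ?_, fun i => ?_⟩
  · rw [← Finset.sum_mul, ← Finset.mul_sum]
    have : ∑ i : Fin m, diagonal (Pi.single i (1 : ℝ)) = (1 : Matrix (Fin m) (Fin m) ℝ) := by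
      ext k l
      by_cases h : k = l
      · subst h; simp [Matrix.sum_apply, Pi.single_apply]
      · simp [Matrix.sum_apply, h]
    rw [this, Matrix.mul_one, Matrix.mul_assoc, ← Matrix.mul_assoc T, hT1, Matrix.one_mul, hWN]
  · rw [hG]
    have e1 : W * Wᵀ * A * (W * T * diagonal (Pi.single i 1) * (Tᵀ * N)) =
        W * ((Wᵀ * A * W) * T) * diagonal (Pi.single i 1) * (Tᵀ * N) := by
      simp only [Matrix.mul_assoc]
    rw [e1, hCe, Matrix.mul_assoc (T * diagonal b), hT2, Matrix.mul_one, ← Matrix.mul_assoc W,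
      Matrix.mul_assoc (W * T) (diagonal b), diagonal_mul_diagonal]
    have : (diagonal fun j => b j * (Pi.single i 1 : Fin m → ℝ) j) = b i • diagonal (Pi.single i (1 : ℝ)) := by
      ext k l
      by_cases h : k = l
      · subst h
        by_cases h2 : k = i
        · subst h2; simp
        · simp [h2]
      · simp [h]
    rw [this]
    simp

end LinAlg

section MatRes
open Matrix

/-- The space of bounded continuous curves. -/
abbrev EE (m : ℕ) := ℝ →ᵇ (Fin m → ℝ)

instance EE_continuousAdd (m : ℕ) : ContinuousAdd (EE m →L[ℝ] EE m) := by
  let _ : SeminormedAddCommGroup (EE m →L[ℝ] EE m) := inferInstance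
  infer_instance

/-- pointwise application of a matrix -/
def hat {m : ℕ} (L : Matrix (Fin m) (Fin m) ℝ) : EE m →L[ℝ] EE m :=
  ContinuousLinearMap.compLeftContinuousBounded ℝ (LinearMap.toContinuousLinearMap L.mulVecLin)

@[simp] lemma hat_apply {m : ℕ} (L : Matrix (Fin m) (Fin m) ℝ) (x : EE m) (t : ℝ) :
    hat L x t = L *ᵥ x t := rfl

lemma hat_tr {m : ℕ} (L : Matrix (Fin m) (Fin m) ℝ) (s : ℝ) (x : EE m) :
    hat L (tr _ s x) = tr _ s (hat L x) := rfl

lemma hasDerivAt_mulVec {m : ℕ} (L : Matrix (Fin m) (Fin m) ℝ) {x : ℝ → Fin m → ℝ} {x' : Fin m → ℝ}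
    {t : ℝ} (h : HasDerivAt x x' t) : HasDerivAt (fun t => L *ᵥ x t) (L *ᵥ x') t :=
  (LinearMap.toContinuousLinearMap L.mulVecLin).hasFDerivAt.comp_hasDerivAt t h

/-- resolvent of the scaled linear equation. -/
structure IsRes {m : ℕ} (B : Matrix (Fin m) (Fin m) ℝ) (R : ℝ → (EE m →L[ℝ] EE m)) (C : ℝ) : Prop where
  nonneg : 0 ≤ C
  bound : ∀ lam, 0 < lam → ‖R lam‖ ≤ C / lam
  deriv : ∀ lam, 0 < lam → ∀ h t, HasDerivAt (R lam h) (h t - lam • (B *ᵥ R lam h t)) t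
  trans : ∀ lam, 0 < lam → ∀ s h, R lam (tr _ s h) = tr _ s (R lam h)
  cont : ContinuousOn R (Set.Ioi 0)
  avg : ∀ lam, 0 < lam → ∀ h U r : EE m, (∀ t, HasDerivAt U (h t - r t) t) →
    ‖R lam h‖ ≤ C * (‖U‖ + ‖r‖ / lam)

lemma exists_isRes {m : ℕ} {Γ A : Matrix (Fin m) (Fin m) ℝ} (hΓ : Γ.PosDef) (hA : A.PosDef) :
    ∃ R C, IsRes (Γ⁻¹ * A) R C := by
  obtain ⟨P, b, hb, hP1, hPb⟩ := simul_diag hΓ hA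
  have hC : 0 ≤ ∑ i, ‖hat (P i)‖ * (2 + 1 / b i) := Finset.sum_nonneg fun i _ => by
    have := hb i; positivity
  refine ⟨fun lam => ∑ i, (hat (P i)).comp (res _ (lam * b i)), ∑ i, ‖hat (P i)‖ * (2 + 1 / b i), ?_⟩
  refine ⟨hC, fun lam hl => ?_, fun lam hl h t => ?_, fun lam hl s h => ?_, ?_, fun lam hl h U r hU => ?_⟩
  · refine (norm_sum_le (E := EE m →L[ℝ] EE m) _ _).trans ?_
    rw [Finset.sum_div]
    refine Finset.sum_le_sum fun i _ => ?_
    have hbi := hb i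
    refine (ContinuousLinearMap.opNorm_comp_le _ _).trans ?_
    rw [mul_div_assoc]
    refine mul_le_mul_of_nonneg_left ?_ (norm_nonneg _)
    refine (res_norm (mul_pos hl hbi)).trans ?_
    rw [one_div, mul_inv, div_eq_mul_inv, mul_comm]
    refine mul_le_mul_of_nonneg_right ?_ (by positivity)
    rw [one_div]; linarith
  · have e : ∀ t, (∑ i, (hat (P i)).comp (res _ (lam * b i))) h t =
        ∑ i, P i *ᵥ res _ (lam * b i) h t := by
      intro t
      simp [BoundedContinuousFunction.sum_apply]
    have e' : ⇑((∑ i, (hat (P i)).comp (res _ (lam * b i))) h) =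
        fun t => ∑ i, P i *ᵥ res _ (lam * b i) h t := funext e
    rw [e']
    have := HasDerivAt.fun_sum (u := Finset.univ) fun i _ =>
      hasDerivAt_mulVec (P i) (res_deriv (mul_pos hl (hb i)) h t)
    refine this.congr_deriv ?_
    simp only [mulVec_sub, mulVec_smul, Finset.sum_sub_distrib]
    rw [← sum_mulVec, hP1, one_mulVec, mulVec_sum, Finset.smul_sum]
    congr 1
    refine Finset.sum_congr rfl fun i _ => ?_
    rw [mulVec_mulVec, hPb, smul_mulVec, smul_smul]
  · simp only [_root_.sum_apply, ContinuousLinearMap.comp_apply]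
    simp only [res_tr (mul_pos hl (hb _)), hat_tr]
    ext1 t
    simp [BoundedContinuousFunction.sum_apply]
  · refine continuousOn_finsetSum _ fun i _ => ?_
    refine ContinuousOn.clm_comp continuousOn_const ?_
    exact res_continuousOn.comp (by fun_prop) fun lam hl => mul_pos hl (hb i)
  · rw [_root_.sum_apply]
    refine (norm_sum_le _ _).trans ?_
    rw [Finset.sum_mul]
    refine Finset.sum_le_sum fun i _ => ?_
    have hbi := hb i
    rw [ContinuousLinearMap.comp_apply]
    refine (ContinuousLinearMap.le_opNorm _ _).trans ?_
    rw [mul_assoc]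
    refine mul_le_mul_of_nonneg_left ?_ (norm_nonneg _)
    refine (res_average (mul_pos hl hbi) h U r hU).trans ?_
    have : ‖r‖ / (lam * b i) = 1 / b i * (‖r‖ / lam) := by field_simp
    rw [this]
    have h1 : 0 ≤ ‖r‖ / lam := by positivity
    have h2 : 0 ≤ 1 / b i * ‖U‖ := by positivity
    nlinarith

end MatRes

section Nem
open Matrix

lemma nem_bound {m : ℕ} {g : (Fin m → ℝ) → (Fin m → ℝ)} (hg : Continuous g) (c : Fin m → ℝ)
    (x : EE m) : ∃ M, ∀ t, ‖g (c + x t)‖ ≤ M := by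
  obtain ⟨M, hM⟩ := (isCompact_closedBall c ‖x‖).exists_bound_of_continuousOn hg.continuousOn
  refine ⟨M, fun t => hM _ ?_⟩
  rw [mem_closedBall_iff_norm, add_sub_cancel_left]
  exact x.norm_coe_le_norm t

/-- the composition operator -/
def nem {m : ℕ} {g : (Fin m → ℝ) → (Fin m → ℝ)} (hg : Continuous g) (c : Fin m → ℝ) (x : EE m) :
    EE m :=
  BoundedContinuousFunction.ofNormedAddCommGroup (fun t => g (c + x t)) (by fun_prop)
    (nem_bound hg c x).choose (nem_bound hg c x).choose_spec

lemma nem_apply {m : ℕ} {g : (Fin m → ℝ) → (Fin m → ℝ)} (hg : Continuous g) (c : Fin m → ℝ)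
    (x : EE m) (t : ℝ) : nem hg c x t = g (c + x t) := rfl

lemma nem_analytic {m : ℕ} {g : (Fin m → ℝ) → (Fin m → ℝ)} (hg : Continuous g) (c : Fin m → ℝ)
    (hgan : AnalyticAt ℝ g c) (A : Matrix (Fin m) (Fin m) ℝ)
    (hA : ∀ v, fderiv ℝ g c v = A *ᵥ v) :
    AnalyticAt ℝ (nem hg c) 0 ∧ HasStrictFDerivAt (nem hg c) (hat A) 0 := by
  obtain ⟨C, r, hC, hr, hUB⟩ := UB_local g c hgan
  have hU := hUB.self_of_nhds
  have key := nemytskii (T := ℝ) (fun n _ => (n.factorial : ℝ)⁻¹ • iteratedFDeriv ℝ n g c)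
    (fun n => continuous_const) C r hC hr (fun n _ => hU.1 n) (fun _ v => g (c + v))
    (fun _ v hv => hU.2 v hv) (nem hg c) (fun y t _ => rfl)
  refine ⟨key.analyticAt, ?_⟩
  have h1 := key.hasFPowerSeriesAt.hasStrictFDerivAt
  refine h1.congr_fderiv ?_
  ext1 y
  ext1 t
  rw [hat_apply, ← hA]
  rw [continuousMultilinearCurryFin1_apply, nemMul_apply]
  simp

end Nem

section Contraction

lemma contraction {E : Type*} [NormedAddCommGroup E] [NormedSpace ℝ E] [CompleteSpace E]
    (P J : ℝ → (E →L[ℝ] E)) (C : ℝ) (hC : 0 ≤ C)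
    (hP : ∀ ε, 0 < ε → ‖P ε‖ ≤ C) (hJ : ∀ ε, 0 < ε → ‖J ε‖ ≤ C * ε ^ 2)
    (A : E →L[ℝ] E) (Q : E → E) (hQ0 : Q 0 = 0) (hQan : AnalyticAt ℝ Q 0)
    (hQd : HasStrictFDerivAt Q (0 : E →L[ℝ] E) 0) :
    ∃ r > 0, ∃ ε₁ > 0, (∀ x ∈ Metric.ball (0 : E) r, ‖Q x‖ ≤ r) ∧ ∀ ε ∈ Set.Ioo (0 : ℝ) ε₁,
      (∀ x ∈ Metric.ball (0 : E) r, AnalyticAt ℝ (fun x => P ε (Q x) + J ε (A x + Q x)) x) ∧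
      LipschitzOnWith (1 / 2) (fun x => P ε (Q x) + J ε (A x + Q x)) (Metric.ball 0 r) := by
  set κ : ℝ := 1 / (4 * (C + 1)) with hκ
  have hκ0 : 0 < κ := by positivity
  have hκ1 : κ ≤ 1 := by
    rw [hκ, div_le_one (by positivity)]; linarith
  have hCκ : C * κ ≤ 1 / 4 := by
    rw [hκ, mul_one_div, div_le_iff₀ (by positivity)]; linarith
  obtain ⟨s, hs, hLip⟩ := hQd.exists_lipschitzOnWith_of_nnnorm_lt ⟨κ, hκ0.le⟩
    (by rw [nnnorm_zero]; exact hκ0)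
  obtain ⟨r, hr, hrs⟩ := Metric.mem_nhds_iff.1 (inter_mem hs hQan.eventually_analyticAt)
  have hQl : ∀ x ∈ Metric.ball (0 : E) r, ∀ y ∈ Metric.ball (0 : E) r, ‖Q x - Q y‖ ≤ κ * ‖x - y‖ := by
    intro x hx y hy
    have := hLip.dist_le_mul x (hrs hx).1 y (hrs hy).1
    rwa [dist_eq_norm, dist_eq_norm] at this
  refine ⟨r, hr, min 1 (1 / (4 * (C + 1) * (‖A‖ + 1))), by positivity, fun x hx => ?_, fun ε hε => ⟨fun x hx => ?_, ?_⟩⟩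
  · have := hQl x hx 0 (Metric.mem_ball_self hr)
    rw [hQ0, sub_zero, sub_zero] at this
    have hx' : ‖x‖ < r := by simpa using hx
    nlinarith [norm_nonneg x]
  · have hq : AnalyticAt ℝ Q x := (hrs hx).2
    exact (((P ε).analyticAt _).comp hq).add (((J ε).analyticAt _).comp ((A.analyticAt x).add hq))
  · refine LipschitzOnWith.of_dist_le_mul fun x hx y hy => ?_
    have hε0 := hε.1
    have hε1 : ε < 1 := hε.2.trans_le (min_le_left _ _)
    have hε2 : ε < 1 / (4 * (C + 1) * (‖A‖ + 1)) := hε.2.trans_le (min_le_right _ _)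
    have hq := hQl x hx y hy
    have e : P ε (Q x) + J ε (A x + Q x) - (P ε (Q y) + J ε (A y + Q y)) =
        P ε (Q x - Q y) + J ε (A (x - y) + (Q x - Q y)) := by
      simp only [map_sub, map_add]; abel
    rw [dist_eq_norm, dist_eq_norm, e]
    have h1 : ‖P ε (Q x - Q y)‖ ≤ C * (κ * ‖x - y‖) :=
      (P ε).le_of_opNorm_le_of_le (hP ε hε0) hq
    have h2 : ‖J ε (A (x - y) + (Q x - Q y))‖ ≤ C * ε ^ 2 * (‖A‖ * ‖x - y‖ + κ * ‖x - y‖) :=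
      (J ε).le_of_opNorm_le_of_le (hJ ε hε0) (norm_add_le_of_le (A.le_opNorm _) hq)
    have h3 : C * ε ^ 2 * (‖A‖ + κ) ≤ 1 / 4 := by
      have : (C + 1) * ε * (‖A‖ + 1) ≤ 1 / 4 := by
        rw [lt_div_iff₀ (by positivity)] at hε2
        nlinarith
      refine le_trans ?_ this
      have : ε ^ 2 ≤ ε := by nlinarith
      gcongr
      linarith
    refine (norm_add_le _ _).trans ((add_le_add h1 h2).trans ?_)
    have : ((1 / 2 : NNReal) : ℝ) = 1 / 2 := by norm_num
    rw [this]
    have hn := norm_nonneg (x - y)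
    nlinarith

end Contraction

section OpsGeneric

variable {E : Type*} [NormedAddCommGroup E] [NormedSpace ℝ E]

/-- slow resolvent -/
def oP (R : ℝ → (E →L[ℝ] E)) (S : E →L[ℝ] E) (ε : ℝ) : E →L[ℝ] E := ε • (R ε).comp S

/-- fast resolvent -/
def oG (R : ℝ → (E →L[ℝ] E)) (ε : ℝ) : E →L[ℝ] E := ε⁻¹ • R ε⁻¹

/-- correction operator -/
def oJ (R1 R2 : ℝ → (E →L[ℝ] E)) (S A : E →L[ℝ] E) (ε : ℝ) : E →L[ℝ] E :=
  ε ^ 2 • ((oP R1 S ε).comp (A.comp S) - S).comp (oG R2 ε)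

lemma oP_apply (R : ℝ → (E →L[ℝ] E)) (S : E →L[ℝ] E) (ε : ℝ) (h : E) :
    oP R S ε h = ε • R ε (S h) := rfl

lemma oG_apply (R : ℝ → (E →L[ℝ] E)) (ε : ℝ) (h : E) : oG R ε h = ε⁻¹ • R ε⁻¹ h := rfl

lemma oJ_apply (R1 R2 : ℝ → (E →L[ℝ] E)) (S A : E →L[ℝ] E) (ε : ℝ) (h : E) :
    oJ R1 R2 S A ε h = ε ^ 2 • (oP R1 S ε (A (S (oG R2 ε h))) - S (oG R2 ε h)) := rfl

lemma oP_norm (R : ℝ → (E →L[ℝ] E)) (S : E →L[ℝ] E) (C : ℝ)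
    (hR : ∀ ε, 0 < ε → ‖R ε‖ ≤ C / ε) (ε : ℝ) (hε : 0 < ε) : ‖oP R S ε‖ ≤ C * ‖S‖ := by
  rw [oP]
  rw [norm_smul]
  rw [Real.norm_of_nonneg hε.le]
  have := (ContinuousLinearMap.opNorm_comp_le (R ε) S).trans
    (mul_le_mul_of_nonneg_right (hR ε hε) (norm_nonneg _))
  refine (mul_le_mul_of_nonneg_left this hε.le).trans (le_of_eq ?_)
  field_simp

lemma oG_norm (R : ℝ → (E →L[ℝ] E)) (C : ℝ)
    (hR : ∀ ε, 0 < ε → ‖R ε‖ ≤ C / ε) (ε : ℝ) (hε : 0 < ε) : ‖oG R ε‖ ≤ C := by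
  rw [oG]
  rw [norm_smul]
  have hi : 0 < ε⁻¹ := inv_pos.2 hε
  rw [Real.norm_of_nonneg hi.le]
  refine (mul_le_mul_of_nonneg_left (hR _ hi) hi.le).trans (le_of_eq ?_)
  field_simp

lemma oJ_norm (R1 R2 : ℝ → (E →L[ℝ] E)) (S A : E →L[ℝ] E) (C1 C2 : ℝ) (h1 : 0 ≤ C1) (_h2 : 0 ≤ C2)
    (hR1 : ∀ ε, 0 < ε → ‖R1 ε‖ ≤ C1 / ε) (hR2 : ∀ ε, 0 < ε → ‖R2 ε‖ ≤ C2 / ε)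
    (ε : ℝ) (hε : 0 < ε) :
    ‖oJ R1 R2 S A ε‖ ≤ (C1 * ‖S‖ * (‖A‖ * ‖S‖) + ‖S‖) * C2 * ε ^ 2 := by
  rw [oJ]
  rw [norm_smul]
  rw [Real.norm_of_nonneg (by positivity), mul_comm]
  refine mul_le_mul_of_nonneg_right ?_ (by positivity)
  refine (ContinuousLinearMap.opNorm_comp_le _ _).trans ?_
  refine mul_le_mul ?_ (oG_norm R2 C2 hR2 ε hε) (norm_nonneg _) (by positivity)
  refine (norm_sub_le _ _).trans ?_
  refine add_le_add ?_ le_rfl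
  refine (ContinuousLinearMap.opNorm_comp_le _ _).trans ?_
  exact mul_le_mul (oP_norm R1 S C1 hR1 ε hε) (ContinuousLinearMap.opNorm_comp_le _ _)
    (norm_nonneg _) (by positivity)

lemma oP_cont (R : ℝ → (E →L[ℝ] E)) (S : E →L[ℝ] E) (hR : ContinuousOn R (Set.Ioi 0)) :
    ContinuousOn (oP R S) (Set.Ioi 0) :=
  continuousOn_id.smul (hR.clm_comp continuousOn_const)

lemma oG_cont (R : ℝ → (E →L[ℝ] E)) (hR : ContinuousOn R (Set.Ioi 0)) :
    ContinuousOn (oG R) (Set.Ioi 0) := by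
  have hi : ContinuousOn (fun ε : ℝ => ε⁻¹) (Set.Ioi 0) :=
    continuousOn_id.inv₀ fun x hx => (ne_of_gt hx)
  exact hi.smul (hR.comp hi fun x (hx : 0 < x) => (inv_pos.2 hx : 0 < x⁻¹))

lemma oJ_cont (R1 R2 : ℝ → (E →L[ℝ] E)) (S A : E →L[ℝ] E) (hR1 : ContinuousOn R1 (Set.Ioi 0))
    (hR2 : ContinuousOn R2 (Set.Ioi 0)) : ContinuousOn (oJ R1 R2 S A) (Set.Ioi 0) :=
  (continuousOn_id.pow 2).smul
    ((((oP_cont R1 S hR1).clm_comp continuousOn_const).sub continuousOn_const).clm_comp (oG_cont R2 hR2))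

end OpsGeneric

section Ops
open Matrix

lemma oP_tr {m : ℕ} {B : Matrix (Fin m) (Fin m) ℝ} {R : ℝ → (EE m →L[ℝ] EE m)} {C : ℝ}
    (hR : IsRes B R C) (S : Matrix (Fin m) (Fin m) ℝ) (ε : ℝ) (hε : 0 < ε) (s : ℝ) (h : EE m) :
    oP R (hat S) ε (tr _ s h) = tr _ s (oP R (hat S) ε h) := by
  rw [oP_apply, oP_apply, hat_tr, hR.trans ε hε]
  rfl

lemma oG_tr {m : ℕ} {B : Matrix (Fin m) (Fin m) ℝ} {R : ℝ → (EE m →L[ℝ] EE m)} {C : ℝ}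
    (hR : IsRes B R C) (ε : ℝ) (hε : 0 < ε) (s : ℝ) (h : EE m) :
    oG R ε (tr _ s h) = tr _ s (oG R ε h) := by
  rw [oG_apply, oG_apply, hR.trans _ (inv_pos.2 hε)]
  rfl

lemma oJ_tr {m : ℕ} {B1 B2 : Matrix (Fin m) (Fin m) ℝ} {R1 R2 : ℝ → (EE m →L[ℝ] EE m)} {C1 C2 : ℝ}
    (hR1 : IsRes B1 R1 C1) (hR2 : IsRes B2 R2 C2) (S A : Matrix (Fin m) (Fin m) ℝ)
    (ε : ℝ) (hε : 0 < ε) (s : ℝ) (h : EE m) :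
    oJ R1 R2 (hat S) (hat A) ε (tr _ s h) = tr _ s (oJ R1 R2 (hat S) (hat A) ε h) := by
  rw [oJ_apply, oJ_apply, oG_tr hR2 ε hε, hat_tr, hat_tr, oP_tr hR1 S ε hε]
  rfl

lemma oP_avg {m : ℕ} {B : Matrix (Fin m) (Fin m) ℝ} {R : ℝ → (EE m →L[ℝ] EE m)} {C : ℝ}
    (hR : IsRes B R C) (S : Matrix (Fin m) (Fin m) ℝ) (ε : ℝ) (hε : 0 < ε)
    (h U r : EE m) (hU : ∀ t, HasDerivAt U (h t - r t) t) :
    ‖oP R (hat S) ε h‖ ≤ C * ‖(hat S : EE m →L[ℝ] EE m)‖ * (ε * ‖U‖ + ‖r‖) := by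
  have h1 := hR.avg ε hε (hat S h) (hat S U) (hat S r) (fun t => by
    refine (hasDerivAt_mulVec S (hU t)).congr_deriv ?_
    rw [mulVec_sub]; rfl)
  rw [oP_apply, norm_smul, Real.norm_of_nonneg hε.le]
  have hU1 : ‖hat S U‖ ≤ ‖(hat S : EE m →L[ℝ] EE m)‖ * ‖U‖ := (hat S).le_opNorm U
  have hr1 : ‖hat S r‖ ≤ ‖(hat S : EE m →L[ℝ] EE m)‖ * ‖r‖ := (hat S).le_opNorm r
  have hC := hR.nonneg
  generalize ‖(hat S : EE m →L[ℝ] EE m)‖ = γ at *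
  calc ε * ‖R ε (hat S h)‖ ≤ ε * (C * (γ * ‖U‖ + γ * ‖r‖ / ε)) := by
        refine mul_le_mul_of_nonneg_left (h1.trans ?_) hε.le
        gcongr
    _ = C * γ * (ε * ‖U‖ + ‖r‖) := by field_simp

lemma ops_ode {m : ℕ} {Γ A : Matrix (Fin m) (Fin m) ℝ} (hdet : IsUnit Γ.det)
    {R1 R2 : ℝ → (EE m →L[ℝ] EE m)} {C1 C2 : ℝ}
    (hR1 : IsRes (Γ⁻¹ * A) R1 C1) (hR2 : IsRes Γ R2 C2) (ε : ℝ) (hε : 0 < ε) (x h q : EE m)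
    (hx : x + (oP R1 (hat Γ⁻¹) ε q + oJ R1 R2 (hat Γ⁻¹) (hat A) ε (hat A x + q)) =
      oP R1 (hat Γ⁻¹) ε h + oJ R1 R2 (hat Γ⁻¹) (hat A) ε h) :
    ∃ v w : ℝ → (Fin m → ℝ), ∀ t, HasDerivAt x (v t) t ∧ HasDerivAt v (w t) t ∧
      ε • w t + Γ *ᵥ v t = ε • (h t - A *ᵥ x t - q t) := by
  obtain ⟨F, hF⟩ : ∃ F : EE m, F = h - hat A x - q := ⟨_, rfl⟩
  obtain ⟨z, hz⟩ : ∃ z : EE m, z = oG R2 ε F := ⟨_, rfl⟩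
  obtain ⟨v, hv⟩ : ∃ v : EE m, v = ε • z := ⟨_, rfl⟩
  have e3 : ∀ t, F t = h t - A *ᵥ x t - q t := fun t => by rw [hF]; rfl
  have e5 : ∀ t, v t = ε • z t := fun t => by rw [hv]; rfl
  have hvd : ∀ t, HasDerivAt v (F t - Γ *ᵥ z t) t := by
    intro t
    have h1 := ((hR2.deriv ε⁻¹ (inv_pos.2 hε) F t).const_smul ε⁻¹).const_smul ε
    have e : ⇑v = fun t => ε • ε⁻¹ • R2 ε⁻¹ F t := by
      ext1 t; rw [e5, hz]; rfl
    rw [e]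
    refine h1.congr_deriv ?_
    have : z t = ε⁻¹ • R2 ε⁻¹ F t := by rw [hz]; rfl
    rw [this, smul_smul, mul_inv_cancel₀ hε.ne', one_smul, mulVec_smul]
  obtain ⟨h2, hh2⟩ : ∃ h2 : EE m, h2 = h - q + ε • hat A (hat Γ⁻¹ v) := ⟨_, rfl⟩
  obtain ⟨y, hyd⟩ : ∃ y : EE m, y = oP R1 (hat Γ⁻¹) ε h2 := ⟨_, rfl⟩
  have hPd : ∀ t, HasDerivAt y (ε • (Γ⁻¹ *ᵥ h2 t) - ε • ((Γ⁻¹ * A) *ᵥ y t)) t := by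
    intro t
    have h1 := (hR1.deriv ε hε (hat Γ⁻¹ h2) t).const_smul ε
    have e : ∀ t, y t = ε • R1 ε (hat Γ⁻¹ h2) t := fun t => by rw [hyd]; rfl
    have e' : ⇑y = fun t => ε • R1 ε (hat Γ⁻¹ h2) t := funext e
    rw [e t, e']
    refine h1.congr_deriv ?_
    rw [smul_sub, mulVec_smul]
    rfl
  have hxe : x = y - ε • hat Γ⁻¹ v := by
    have e1 : x = oP R1 (hat Γ⁻¹) ε h - oP R1 (hat Γ⁻¹) ε q + oJ R1 R2 (hat Γ⁻¹) (hat A) ε F := by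
      have hFe : h = F + (hat A x + q) := by rw [hF]; abel
      have : oJ R1 R2 (hat Γ⁻¹) (hat A) ε h = oJ R1 R2 (hat Γ⁻¹) (hat A) ε F +
          oJ R1 R2 (hat Γ⁻¹) (hat A) ε (hat A x + q) := by
        rw [← map_add, ← hFe]
      rw [this] at hx
      rw [eq_sub_of_add_eq hx]
      abel
    rw [e1, oJ_apply, hyd, hh2, hv, ← hz]
    simp only [map_add, map_sub, map_smul, smul_sub, smul_smul]
    rw [pow_two]
    abel
  have hy : ∀ t, y t = x t + ε • (Γ⁻¹ *ᵥ v t) := by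
    intro t
    have := DFunLike.congr_fun hxe t
    rw [this]
    simp
  have hxd : ∀ t, HasDerivAt x (v t) t := by
    intro t
    have h1 := (hPd t).sub ((hasDerivAt_mulVec Γ⁻¹ (hvd t)).const_smul ε)
    have e : ⇑x = fun t => y t - ε • (Γ⁻¹ *ᵥ v t) := by
      ext1 t; rw [hy]; simp
    rw [e]
    refine h1.congr_deriv ?_
    rw [hy]
    have e2 : h2 t = h t - q t + ε • (A *ᵥ (Γ⁻¹ *ᵥ v t)) := by rw [hh2]; rfl
    have e4 : Γ⁻¹ *ᵥ (Γ *ᵥ z t) = z t := by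
      rw [mulVec_mulVec, nonsing_inv_mul _ hdet, one_mulVec]
    rw [mulVec_sub, e4, e2, e3, e5]
    simp only [mulVec_sub, mulVec_add, mulVec_smul, smul_sub, smul_add, mulVec_mulVec, Matrix.mul_assoc]
    abel
  refine ⟨v, fun t => F t - Γ *ᵥ z t, fun t => ⟨hxd t, hvd t, ?_⟩⟩
  rw [e5, mulVec_smul, ← e3, smul_sub]
  abel

lemma exists_ops {m : ℕ} {Γ A : Matrix (Fin m) (Fin m) ℝ} (hΓ : Γ.PosDef) (hA : A.PosDef) :
    ∃ (P J : ℝ → (EE m →L[ℝ] EE m)) (C : ℝ), 0 ≤ C ∧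
      (∀ ε, 0 < ε → ‖P ε‖ ≤ C) ∧ (∀ ε, 0 < ε → ‖J ε‖ ≤ C * ε ^ 2) ∧
      (∀ ε, 0 < ε → ∀ s h, P ε (tr _ s h) = tr _ s (P ε h)) ∧
      (∀ ε, 0 < ε → ∀ s h, J ε (tr _ s h) = tr _ s (J ε h)) ∧
      ContinuousOn P (Set.Ioi 0) ∧ ContinuousOn J (Set.Ioi 0) ∧
      (∀ ε, 0 < ε → ∀ h U r : EE m, (∀ t, HasDerivAt U (h t - r t) t) →
        ‖P ε h‖ ≤ C * (ε * ‖U‖ + ‖r‖)) ∧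
      (∀ ε, 0 < ε → ∀ x h q : EE m, x + (P ε q + J ε (hat A x + q)) = P ε h + J ε h →
        ∃ v w : ℝ → (Fin m → ℝ), ∀ t, HasDerivAt x (v t) t ∧ HasDerivAt v (w t) t ∧
          ε • w t + Γ *ᵥ v t = ε • (h t - A *ᵥ x t - q t)) := by
  obtain ⟨R1, C1, hR1⟩ := exists_isRes hΓ hA
  obtain ⟨R2, C2, hR2⟩ := exists_isRes (Matrix.PosDef.one (n := Fin m) (R := ℝ)) hΓ
  rw [inv_one, Matrix.one_mul] at hR2
  have hdet : IsUnit Γ.det := hΓ.det_pos.ne'.isUnit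
  have hC1 := hR1.nonneg
  have hC2 := hR2.nonneg
  have n1 := oP_norm R1 (hat Γ⁻¹) C1 hR1.bound
  have n2 := oJ_norm R1 R2 (hat Γ⁻¹) (hat A) C1 C2 hC1 hC2 hR1.bound hR2.bound
  have n3 := oP_avg hR1 Γ⁻¹
  have hγ0 : 0 ≤ ‖(hat Γ⁻¹ : EE m →L[ℝ] EE m)‖ := norm_nonneg (hat Γ⁻¹ : EE m →L[ℝ] EE m)
  have ha0 : 0 ≤ ‖(hat A : EE m →L[ℝ] EE m)‖ := norm_nonneg (hat A : EE m →L[ℝ] EE m)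
  generalize ‖(hat Γ⁻¹ : EE m →L[ℝ] EE m)‖ = γ at *
  generalize ‖(hat A : EE m →L[ℝ] EE m)‖ = a at *
  have hD : 0 ≤ (C1 * γ * (a * γ) + γ) * C2 := by positivity
  have hD1 : 0 ≤ C1 * γ := by positivity
  refine ⟨oP R1 (hat Γ⁻¹), oJ R1 R2 (hat Γ⁻¹) (hat A), C1 * γ + (C1 * γ * (a * γ) + γ) * C2,
    by positivity, fun ε hε => (n1 ε hε).trans (by linarith), fun ε hε => (n2 ε hε).trans ?_,
    oP_tr hR1 Γ⁻¹, oJ_tr hR1 hR2 Γ⁻¹ A, oP_cont _ _ hR1.cont, oJ_cont _ _ _ _ hR1.cont hR2.cont,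
    fun ε hε h U r hU => (n3 ε hε h U r hU).trans ?_, ops_ode hdet hR1 hR2⟩
  · exact mul_le_mul_of_nonneg_right (by linarith) (by positivity)
  · exact mul_le_mul_of_nonneg_right (by linarith) (by positivity)

end Ops

section FamilyAbs

lemma family_abs {E : Type*} [NormedAddCommGroup E] [NormedSpace ℝ E] [CompleteSpace E] [Nontrivial E]
    {I : Type*} (P J : ℝ → (E →L[ℝ] E)) (C : ℝ) (hC : 0 ≤ C)
    (hP : ∀ ε, 0 < ε → ‖P ε‖ ≤ C) (hJ : ∀ ε, 0 < ε → ‖J ε‖ ≤ C * ε ^ 2)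
    (cP : ContinuousOn P (Set.Ioi 0)) (cJ : ContinuousOn J (Set.Ioi 0))
    (A : E →L[ℝ] E) (Q : E → E) (hQ0 : Q 0 = 0) (hQan : AnalyticAt ℝ Q 0)
    (hQd : HasStrictFDerivAt Q (0 : E →L[ℝ] E) 0)
    (O : I → E) (M : ℝ) (hM0 : 0 ≤ M) (hM : ∀ ψ, ‖O ψ‖ ≤ M)
    (hsm : ∀ δ > 0, ∃ η > 0, ∀ ε ∈ Set.Ioo (0 : ℝ) η, ∀ ψ, ‖P ε (O ψ)‖ ≤ δ)
    (T : ℝ → E → E) (hTn : ∀ s x, ‖T s x‖ ≤ ‖x‖) (hTa : ∀ s x y, T s (x + y) = T s x + T s y)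
    (hTP : ∀ ε, 0 < ε → ∀ s h, P ε (T s h) = T s (P ε h))
    (hTJ : ∀ ε, 0 < ε → ∀ s h, J ε (T s h) = T s (J ε h))
    (hTA : ∀ s h, A (T s h) = T s (A h)) (hTQ : ∀ s h, Q (T s h) = T s (Q h)) :
    ∃ ε₁ > 0, ∃ x : ℝ → I → E,
      (∀ ε ∈ Set.Ioo (0 : ℝ) ε₁,
        (∀ ψ, x ε ψ + (P ε (Q (x ε ψ)) + J ε (A (x ε ψ) + Q (x ε ψ))) = P ε (O ψ) + J ε (O ψ)) ∧
        (∀ s ψ ψ', O ψ' = T s (O ψ) → x ε ψ' = T s (x ε ψ)) ∧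
        ∃ σ : E → E, ∀ ψ, x ε ψ = σ (P ε (O ψ) + J ε (O ψ)) ∧ AnalyticAt ℝ σ (P ε (O ψ) + J ε (O ψ))) ∧
      (∀ δ > 0, ∃ η > 0, ∀ ε ∈ Set.Ioo (0 : ℝ) η, ∀ ψ, ‖x ε ψ‖ ≤ δ) ∧
      (∀ ε ∈ Set.Ioo (0 : ℝ) ε₁, ∀ δ > 0, ∀ᶠ ε' in nhds ε, ∀ ψ, ‖x ε' ψ - x ε ψ‖ ≤ δ) := by
  obtain ⟨r, hr, ε₁, hε₁, hQr, hK⟩ := contraction P J C hC hP hJ A Q hQ0 hQan hQd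
  have hsm2 : ∀ δ > 0, ∃ η > 0, ∀ ε ∈ Set.Ioo (0 : ℝ) η, ∀ ψ, ‖P ε (O ψ) + J ε (O ψ)‖ < δ := by
    intro δ hδ
    obtain ⟨η, hη, h⟩ := hsm (δ / 4) (by positivity)
    refine ⟨min η (min 1 (δ / (4 * (C + 1) * (M + 1)))), by positivity, fun ε hε ψ => ?_⟩
    have hε0 := hε.1
    have h1 : ε < η := hε.2.trans_le (min_le_left _ _)
    have h2 : ε < 1 := hε.2.trans_le ((min_le_right _ _).trans (min_le_left _ _))
    have h3 : ε < δ / (4 * (C + 1) * (M + 1)) := hε.2.trans_le ((min_le_right _ _).trans (min_le_right _ _))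
    have h4 : ‖J ε (O ψ)‖ ≤ C * ε ^ 2 * M := (J ε).le_of_opNorm_le_of_le (hJ ε hε0) (hM ψ)
    have h5 : C * ε ^ 2 * M ≤ δ / 4 := by
      rw [lt_div_iff₀ (by positivity)] at h3
      have : C * ε ^ 2 * M ≤ (C + 1) * ε * (M + 1) := by
        have : ε ^ 2 ≤ ε := by nlinarith
        gcongr <;> linarith
      nlinarith
    have := norm_add_le_of_le (h ε ⟨hε0, h1⟩ ψ) (h4.trans h5)
    linarith
  obtain ⟨η, hη, hηs⟩ := hsm2 (r / 2) (by positivity)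
  set K : ℝ → E → E := fun ε x => P ε (Q x) + J ε (A x + Q x) with hKd
  have hK0 : ∀ ε, K ε 0 = 0 := fun ε => by simp [hKd, hQ0]
  have hσ : ∀ ε, ∃ σ : E → E, ε ∈ Set.Ioo (0 : ℝ) ε₁ → ∀ h ∈ Metric.ball (0 : E) (r / 2),
      σ h ∈ Metric.ball (0 : E) r ∧ σ h + K ε (σ h) = h ∧ AnalyticAt ℝ σ h := by
    intro ε
    by_cases hε : ε ∈ Set.Ioo (0 : ℝ) ε₁
    · obtain ⟨σ, h⟩ := exists_local_inverse (K ε) r hr (hK0 ε) (hK ε hε).1 (hK ε hε).2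
      exact ⟨σ, fun _ => h⟩
    · exact ⟨id, fun h => absurd h hε⟩
  choose σ hσ using hσ
  have hball : ∀ ε ∈ Set.Ioo (0 : ℝ) (min ε₁ η), ∀ ψ, P ε (O ψ) + J ε (O ψ) ∈ Metric.ball (0 : E) (r / 2) := by
    intro ε hε ψ
    rw [mem_ball_zero_iff]
    exact hηs ε ⟨hε.1, hε.2.trans_le (min_le_right _ _)⟩ ψ
  have hmin : ∀ ε ∈ Set.Ioo (0 : ℝ) (min ε₁ η), ε ∈ Set.Ioo (0 : ℝ) ε₁ := fun ε hε =>
    ⟨hε.1, hε.2.trans_le (min_le_left _ _)⟩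
  set x : ℝ → I → E := fun ε ψ => σ ε (P ε (O ψ) + J ε (O ψ)) with hxd
  have hx : ∀ ε ∈ Set.Ioo (0 : ℝ) (min ε₁ η), ∀ ψ, x ε ψ ∈ Metric.ball (0 : E) r ∧
      x ε ψ + K ε (x ε ψ) = P ε (O ψ) + J ε (O ψ) := fun ε hε ψ =>
    ⟨(hσ ε (hmin ε hε) _ (hball ε hε ψ)).1, (hσ ε (hmin ε hε) _ (hball ε hε ψ)).2.1⟩
  refine ⟨min ε₁ η, by positivity, x, fun ε hε => ⟨fun ψ => (hx ε hε ψ).2, fun s ψ ψ' hO => ?_,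
    σ ε, fun ψ => ⟨rfl, (hσ ε (hmin ε hε) _ (hball ε hε ψ)).2.2⟩⟩, fun δ hδ => ?_, fun ε hε δ hδ => ?_⟩
  · have hTx : T s (x ε ψ) ∈ Metric.ball (0 : E) r := by
      have := (hx ε hε ψ).1
      rw [mem_ball_zero_iff] at this ⊢
      exact (hTn _ _).trans_lt this
    have h1 := inverse_unique (K ε) r (hK ε (hmin ε hε)).2 (hx ε hε ψ').1 hTx
    have h2 : T s (x ε ψ) + K ε (T s (x ε ψ)) = x ε ψ' + K ε (x ε ψ') := by
      rw [(hx ε hε ψ').2, hO, hTP ε hε.1, hTJ ε hε.1, ← hTa, ← (hx ε hε ψ).2]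
      simp only [hKd]
      rw [hTQ, hTA, ← hTa, hTP ε hε.1, hTJ ε hε.1, ← hTa, ← hTa]
    rw [h2, sub_self, norm_zero, mul_zero] at h1
    exact sub_eq_zero.1 (norm_le_zero_iff.1 h1)
  · obtain ⟨η', hη', h⟩ := hsm2 (δ / 2) (by positivity)
    refine ⟨min η' (min ε₁ η), by positivity, fun ε hε ψ => ?_⟩
    have hε' : ε ∈ Set.Ioo (0 : ℝ) (min ε₁ η) := ⟨hε.1, hε.2.trans_le (min_le_right _ _)⟩
    have h1 := inverse_unique (K ε) r (hK ε (hmin ε hε')).2 (hx ε hε' ψ).1 (Metric.mem_ball_self hr)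
    rw [hK0, (hx ε hε' ψ).2, add_zero, sub_zero, sub_zero] at h1
    have := h ε ⟨hε.1, hε.2.trans_le (min_le_left _ _)⟩ ψ
    linarith
  · have hP' : Tendsto (fun ε' => ‖P ε' - P ε‖) (nhds ε) (nhds 0) := by
      have := (cP.continuousAt (Ioi_mem_nhds hε.1)).tendsto
      exact tendsto_iff_norm_sub_tendsto_zero.1 this
    have hJ' : Tendsto (fun ε' => ‖J ε' - J ε‖) (nhds ε) (nhds 0) := by
      have := (cJ.continuousAt (Ioi_mem_nhds hε.1)).tendsto
      exact tendsto_iff_norm_sub_tendsto_zero.1 this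
    have hlim : Tendsto (fun ε' => 2 * (‖P ε' - P ε‖ * (M + r) + ‖J ε' - J ε‖ * (M + (‖A‖ * r + r))))
        (nhds ε) (nhds 0) := by
      have := ((hP'.mul_const (M + r)).add (hJ'.mul_const (M + (‖A‖ * r + r)))).const_mul 2
      simpa using this
    filter_upwards [hlim.eventually (gt_mem_nhds hδ), isOpen_Ioo.mem_nhds hε] with ε' h1 hε' ψ
    refine le_trans ?_ h1.le
    have h2 := inverse_unique (K ε') r (hK ε' (hmin ε' hε')).2 (hx ε' hε' ψ).1 (hx ε hε ψ).1
    refine h2.trans (mul_le_mul_of_nonneg_left ?_ (by norm_num))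
    have e : x ε' ψ + K ε' (x ε' ψ) - (x ε ψ + K ε' (x ε ψ)) =
        (P ε' - P ε) (O ψ - Q (x ε ψ)) + (J ε' - J ε) (O ψ - (A (x ε ψ) + Q (x ε ψ))) := by
      have h3 : x ε ψ = P ε (O ψ) + J ε (O ψ) - K ε (x ε ψ) := eq_sub_of_add_eq (hx ε hε ψ).2
      have h4 : x ε ψ + K ε' (x ε ψ) = P ε (O ψ) + J ε (O ψ) - K ε (x ε ψ) + K ε' (x ε ψ) := by
        rw [← h3]
      rw [(hx ε' hε' ψ).2, h4]
      simp only [hKd, sub_apply, map_sub]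
      abel
    rw [e]
    have hxn : ‖x ε ψ‖ ≤ r := (mem_ball_zero_iff.1 (hx ε hε ψ).1).le
    have hQn := hQr _ (hx ε hε ψ).1
    refine (norm_add_le _ _).trans (add_le_add ?_ ?_)
    · exact (P ε' - P ε).le_of_opNorm_le_of_le le_rfl (norm_sub_le_of_le (hM ψ) hQn)
    · refine (J ε' - J ε).le_of_opNorm_le_of_le le_rfl (norm_sub_le_of_le (hM ψ) ?_)
      exact norm_add_le_of_le (A.le_opNorm_of_le hxn) hQn

end FamilyAbs

section Family
open Matrix MeasureTheory

lemma family {m d : ℕ} (hm : 1 ≤ m) (ω : Fin d → ℝ)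
    (hω : ∀ ν : Fin d → ℤ, ν ≠ 0 → (∑ j, ω j * ν j) ≠ 0)
    {Γ A : Matrix (Fin m) (Fin m) ℝ} (hΓ : Γ.PosDef) (hA : A.PosDef)
    (g : (Fin m → ℝ) → (Fin m → ℝ)) (hg : Continuous g) (c : Fin m → ℝ) (hgan : AnalyticAt ℝ g c)
    (hgA : ∀ v, fderiv ℝ g c v = A *ᵥ v)
    (f : (Fin d → ℝ) → (Fin m → ℝ)) (hper : IsPeriodic2pi d m f) (hfan : AnalyticOnNhd ℝ f Set.univ)
    (hf0 : ∫ ψ in bx d, f ψ = 0) :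
    ∃ ε₁ > 0, ∃ X : ℝ → (Fin d → ℝ) → (Fin m → ℝ),
      (∀ ε ∈ Set.Ioo (0 : ℝ) ε₁, AnalyticOnNhd ℝ (X ε) Set.univ ∧ IsPeriodic2pi d m (X ε) ∧
        ∀ ψ, ∃ v w : ℝ → (Fin m → ℝ), ∀ t, HasDerivAt (fun s : ℝ => X ε (ψ + s • ω)) (v t) t ∧
          HasDerivAt v (w t) t ∧
          ε • w t + Γ *ᵥ v t = ε • (f (ψ + t • ω) + g c - g (c + X ε (ψ + t • ω)))) ∧
      (∀ δ > 0, ∃ η > 0, ∀ ε ∈ Set.Ioo (0 : ℝ) η, ∀ ψ, ‖X ε ψ‖ ≤ δ) ∧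
      (∀ ε ∈ Set.Ioo (0 : ℝ) ε₁, ∀ δ > 0, ∀ᶠ ε' in nhds ε, ∀ ψ, ‖X ε' ψ - X ε ψ‖ ≤ δ) := by
  have : Nonempty (Fin m) := ⟨⟨0, hm⟩⟩
  have : Nontrivial (Fin m → ℝ) := inferInstance
  have : Nontrivial (EE m) := by
    obtain ⟨v, hv⟩ := exists_ne (0 : Fin m → ℝ)
    refine ⟨⟨constCLM _ v, 0, fun h => hv ?_⟩⟩
    exact DFunLike.congr_fun h (0 : ℝ)
  have hfc : Continuous f := continuousOn_univ.1 hfan.continuousOn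
  obtain ⟨M, hM⟩ := periodic_bounded f hper hfc
  have hM0 : 0 ≤ M := (norm_nonneg _).trans (hM 0)
  obtain ⟨CU, rU, hCU, hrU, hUB⟩ := periodic_UB f hper hfan
  obtain ⟨P, J, C, hC, hP, hJ, tP, tJ, cP, cJ, avg, ode⟩ := exists_ops hΓ hA
  obtain ⟨nan, nd⟩ := nem_analytic hg c hgan A hgA
  let Q : EE m → EE m := fun x => nem hg c x - nem hg c 0 - hat A x
  have hQ0 : Q 0 = 0 := by simp [Q]
  have hQan : AnalyticAt ℝ Q 0 := (nan.sub analyticAt_const).sub ((hat A).analyticAt 0)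
  have hQd : HasStrictFDerivAt Q (0 : EE m →L[ℝ] EE m) 0 := by
    have := (nd.sub_const (nem hg c 0)).sub (hat A).hasStrictFDerivAt
    refine this.congr_fderiv ?_
    exact sub_self _
  have hOn : ∀ ψ, ‖orb f hfc M hM ω ψ‖ ≤ M := fun ψ =>
    (BoundedContinuousFunction.norm_le hM0).2 fun t => hM _
  have hsm : ∀ δ > 0, ∃ η > 0, ∀ ε ∈ Set.Ioo (0 : ℝ) η, ∀ ψ, ‖P ε (orb f hfc M hM ω ψ)‖ ≤ δ := by
    intro δ hδ
    obtain ⟨N, hN, hav⟩ := averaging ω hω f hfc hper hf0 (δ / (2 * (C + 1))) (by positivity)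
    refine ⟨δ / (2 * (C + 1) * (N + 1)), by positivity, fun ε hε ψ => ?_⟩
    obtain ⟨U, r, hU, hr, hd⟩ := hav ψ
    refine (avg ε hε.1 _ U r hd).trans ?_
    have h1 := hε.2
    have hε0 := hε.1
    rw [lt_div_iff₀ (by positivity)] at h1
    have h2 : C * (ε * ‖U‖ + ‖r‖) ≤ (C + 1) * (ε * (N + 1) + δ / (2 * (C + 1))) := by
      gcongr
      · linarith
      · linarith
    refine h2.trans ?_
    have h3 : (C + 1) * (ε * (N + 1) + δ / (2 * (C + 1))) = (C + 1) * ε * (N + 1) + δ / 2 := by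
      field_simp
    rw [h3]
    nlinarith
  obtain ⟨ε₁, hε₁, x, h1, h2, h3⟩ := family_abs P J C hC hP hJ cP cJ (hat A) Q hQ0 hQan hQd
    (orb f hfc M hM ω) M hM0 hOn hsm (tr _) (fun s x => tr_norm s x) (fun s x y => rfl) tP tJ
    (fun s h => rfl) (fun s h => rfl)
  refine ⟨ε₁, hε₁, fun ε ψ => x ε ψ 0, fun ε hε => ?_, fun δ hδ => ?_, fun ε hε δ hδ => ?_⟩
  · obtain ⟨heq, hT, σ, hσ⟩ := h1 ε hε
    have hflow : ∀ ψ (t : ℝ), x ε (ψ + t • ω) 0 = x ε ψ t := by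
      intro ψ t
      have := hT t ψ (ψ + t • ω) (by
        ext1 s
        rw [tr_apply, orb_apply, orb_apply, add_smul, add_assoc, add_comm (t • ω)])
      rw [this, tr_apply, zero_add]
    refine ⟨fun ψ _ => ?_, fun ψ k => ?_, fun ψ => ?_⟩
    · have ho := orb_analytic f hfc M hM ω hfan CU rU hCU hrU hUB ψ
      have hs : AnalyticAt ℝ (fun ψ => P ε (orb f hfc M hM ω ψ) + J ε (orb f hfc M hM ω ψ)) ψ :=
        (((P ε).analyticAt _).comp ho).add (((J ε).analyticAt _).comp ho)
      have hx : AnalyticAt ℝ (x ε) ψ := by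
        have e : x ε = fun ψ => σ (P ε (orb f hfc M hM ω ψ) + J ε (orb f hfc M hM ω ψ)) :=
          funext fun ψ => (hσ ψ).1
        rw [e]
        exact AnalyticAt.fun_comp (hσ ψ).2 hs
      exact ((BoundedContinuousFunction.evalCLM ℝ (0 : ℝ)).analyticAt _).comp hx
    · have := hT 0 ψ (fun j => ψ j + 2 * π * k j) (by
        ext1 s
        rw [tr_apply, orb_apply, orb_apply, add_zero, ← hper (ψ + s • ω) k]
        congr 1
        ext j
        simp
        ring)
      change x ε _ 0 = x ε ψ 0
      rw [this, tr_apply, zero_add]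
    · obtain ⟨v, w, hvw⟩ := ode ε hε.1 (x ε ψ) _ _ (heq ψ)
      refine ⟨v, w, fun t => ?_⟩
      simp only [hflow]
      obtain ⟨a1, a2, a3⟩ := hvw t
      refine ⟨a1, a2, a3.trans ?_⟩
      congr 1
      have e1 : Q (x ε ψ) t = g (c + x ε ψ t) - g (c + 0) - A *ᵥ x ε ψ t := rfl
      rw [e1, orb_apply, add_zero]
      abel
  · obtain ⟨η, hη, h⟩ := h2 δ hδ
    exact ⟨η, hη, fun ε hε ψ => ((x ε ψ).norm_coe_le_norm 0).trans (h ε hε ψ)⟩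
  · filter_upwards [h3 ε hε δ hδ] with ε' h ψ
    exact ((x ε' ψ - x ε ψ).norm_coe_le_norm 0).trans (h ψ)

end Family

section Final
open Matrix MeasureTheory

lemma boxMean_norm {d m : ℕ} (F : (Fin d → ℝ) → (Fin m → ℝ)) (M : ℝ) (hM : ∀ ψ, ‖F ψ‖ ≤ M) :
    ‖boxMean d m F‖ ≤ M := by
  have h1 := norm_setIntegral_le_of_norm_le_const (μ := volume) (bx_compact d).measure_lt_top
    (fun ψ _ => hM ψ)
  rw [bx_volume] at h1
  rw [boxMean, norm_smul, Real.norm_of_nonneg (by positivity)]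
  refine (mul_le_mul_of_nonneg_left h1 (by positivity)).trans (le_of_eq ?_)
  rw [inv_pow]
  field_simp

lemma boxMean_sub {d m : ℕ} (F G : (Fin d → ℝ) → (Fin m → ℝ)) (hF : Continuous F) (hG : Continuous G) :
    boxMean d m (fun ψ => F ψ - G ψ) = boxMean d m F - boxMean d m G := by
  rw [boxMean, boxMean, boxMean, ← smul_sub]
  congr 1
  exact integral_sub (hF.continuousOn.integrableOn_compact (bx_compact d))
    (hG.continuousOn.integrableOn_compact (bx_compact d))

lemma boxMean_const {d m : ℕ} (v : Fin m → ℝ) : boxMean d m (fun _ => v) = v := by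
  have h1 : ∫ _ψ in bx d, v = ((2 * π) ^ d : ℝ) • v := by rw [setIntegral_const, bx_volume]
  have h2 : boxMean d m (fun _ => v) = ((2 * π)⁻¹ ^ d) • ∫ _ψ in bx d, v := rfl
  rw [h2, h1, smul_smul, inv_pow, inv_mul_cancel₀ (by positivity), one_smul]

lemma integral_of_boxMean {d m : ℕ} (F : (Fin d → ℝ) → (Fin m → ℝ)) (h : boxMean d m F = 0) :
    ∫ ψ in bx d, F ψ = 0 := by
  rw [boxMean] at h
  exact (smul_eq_zero.1 h).resolve_left (by positivity)

lemma grad_analytic {m : ℕ} (V : (Fin m → ℝ) → ℝ) (hV : AnalyticOnNhd ℝ V Set.univ)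
    (g : (Fin m → ℝ) → (Fin m → ℝ)) (hg : ∀ x i, g x i = fderiv ℝ V x (Pi.single i 1)) :
    AnalyticOnNhd ℝ g Set.univ := by
  have h1 : AnalyticOnNhd ℝ (fderiv ℝ V) Set.univ := hV.fderiv
  intro x hx
  rw [analyticAt_pi_iff]
  intro i
  simp only [hg]
  exact ((ContinuousLinearMap.apply ℝ ℝ (Pi.single i 1 : Fin m → ℝ)).analyticAt _).comp (h1 x hx)

lemma grad_fderiv {m : ℕ} (V : (Fin m → ℝ) → ℝ) (hV : AnalyticOnNhd ℝ V Set.univ)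
    (g : (Fin m → ℝ) → (Fin m → ℝ)) (hg : ∀ x i, g x i = fderiv ℝ V x (Pi.single i 1))
    (c : Fin m → ℝ) (hH : (hessianMatrix m V c).IsHermitian) (v : Fin m → ℝ) :
    fderiv ℝ g c v = hessianMatrix m V c *ᵥ v := by
  have h1 : HasFDerivAt (fderiv ℝ V) (fderiv ℝ (fderiv ℝ V) c) c :=
    (hV.fderiv c trivial).differentiableAt.hasFDerivAt
  have hgd : HasFDerivAt g (fderiv ℝ g c) c :=
    (grad_analytic V hV g hg c trivial).differentiableAt.hasFDerivAt
  ext i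
  have h2 : HasFDerivAt (fun x => g x i) ((ContinuousLinearMap.apply ℝ ℝ (Pi.single i 1 : Fin m → ℝ)).comp
      (fderiv ℝ (fderiv ℝ V) c)) c := by
    simp only [hg]
    exact (ContinuousLinearMap.apply ℝ ℝ (Pi.single i 1 : Fin m → ℝ)).hasFDerivAt.comp c h1
  have h3 := (hasFDerivAt_pi'.1 hgd i).unique h2
  have h4 := DFunLike.congr_fun h3 v
  have h5 : fderiv ℝ g c v i = fderiv ℝ (fderiv ℝ V) c v (Pi.single i 1) := h4
  rw [h5, mulVec, dotProduct]
  have hv : v = ∑ j, v j • (Pi.single j 1 : Fin m → ℝ) := by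
    ext k
    simp [Finset.sum_apply, Pi.single_apply]
  conv_lhs => rw [hv]
  rw [map_sum, _root_.sum_apply]
  refine Finset.sum_congr rfl fun j _ => ?_
  have h6 : hessianMatrix m V c i j = hessianMatrix m V c j i := by
    have := hH.apply j i
    simpa using this
  rw [h6, hessianMatrix, of_apply, iteratedFDeriv_two_apply]
  simp [mul_comm]

end Final

end Helpers

theorem response_solution_decomposition
    (m d : ℕ) (hm : 1 ≤ m) (hd : 1 ≤ d)
    (ω : Fin d → ℝ) (hω : ∀ ν : Fin d → ℤ, ν ≠ 0 → (∑ j, ω j * ν j) ≠ 0)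
    (Γ : Matrix (Fin m) (Fin m) ℝ) (hΓsymm : Γ.IsSymm) (hΓpos : Γ.PosDef)
    (V : (Fin m → ℝ) → ℝ) (hV : AnalyticOnNhd ℝ V Set.univ)
    (g : (Fin m → ℝ) → (Fin m → ℝ))
    (hg : ∀ x i, g x i = fderiv ℝ V x (Pi.single i 1))
    (f : (Fin d → ℝ) → (Fin m → ℝ))
    (hfper : IsPeriodic2pi d m f) (hfan : AnalyticOnNhd ℝ f Set.univ)
    (c : Fin m → ℝ) (hc : g c = boxMean d m f)
    (hhess : (hessianMatrix m V c).PosDef) :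
    ∃ ε₀ > (0 : ℝ), ∃ ζ : ℝ → (Fin m → ℝ), ∃ u : ℝ → (Fin d → ℝ) → (Fin m → ℝ),
      ContinuousOn ζ (Set.Ico 0 ε₀) ∧ ζ 0 = 0 ∧
      (∀ ε ∈ Set.Ioo (0 : ℝ) ε₀,
        AnalyticOnNhd ℝ (u ε) Set.univ ∧ IsPeriodic2pi d m (u ε) ∧
        boxMean d m (u ε) = 0 ∧
        ∀ t : ℝ,
          ε • deriv (deriv fun s : ℝ => c + ζ ε + u ε fun j => ω j * s) t
            + Γ.mulVec (deriv (fun s : ℝ => c + ζ ε + u ε fun j => ω j * s) t)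
            + ε • g (c + ζ ε + u ε fun j => ω j * t)
          = ε • f fun j => ω j * t) ∧
      Tendsto (fun ε : ℝ => ⨆ t : ℝ, ‖(c + ζ ε + u ε fun j => ω j * t) - c‖)
        (nhdsWithin 0 (Set.Ioi 0)) (nhds 0) := by
  have hgan := grad_analytic V hV g hg
  have hgc : Continuous g := continuousOn_univ.1 hgan.continuousOn
  have hfc : Continuous f := continuousOn_univ.1 hfan.continuousOn
  obtain ⟨ε₁, hε₁, X, hX, hXs, hXc⟩ := family hm ω hω hΓpos hhess g hgc c (hgan c trivial)
    (grad_fderiv V hV g hg c hhess.1) (fun ψ => f ψ - g c)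
    (fun ψ k => by simp only; rw [hfper ψ k]) (hfan.sub analyticOnNhd_const)
    (integral_of_boxMean _ (by
      rw [boxMean_sub f (fun _ => g c) hfc continuous_const, boxMean_const, hc, sub_self]))
  have hXcont : ∀ ε ∈ Set.Ioo (0 : ℝ) ε₁, Continuous (X ε) := fun ε hε =>
    continuousOn_univ.1 (hX ε hε).1.continuousOn
  set ζ : ℝ → (Fin m → ℝ) := fun ε => if 0 < ε then boxMean d m (X ε) else 0 with hζ
  have hζp : ∀ ε, 0 < ε → ζ ε = boxMean d m (X ε) := fun ε hε => if_pos hε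
  have hζ0 : ζ 0 = 0 := if_neg (lt_irrefl 0)
  have hsum : ∀ ε ψ, c + ζ ε + (X ε ψ - ζ ε) = c + X ε ψ := fun ε ψ => by abel
  have hω' : ∀ s : ℝ, (fun j => ω j * s) = (0 : Fin d → ℝ) + s • ω := fun s => by
    ext j; simp [mul_comm]
  refine ⟨ε₁, hε₁, ζ, fun ε ψ => X ε ψ - ζ ε, ?_, hζ0, fun ε hε => ⟨?_, ?_, ?_, ?_⟩, ?_⟩
  · intro ε hε
    rcases hε.1.eq_or_lt with h0 | h0
    · subst h0
      rw [Metric.continuousWithinAt_iff]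
      intro δ hδ
      obtain ⟨η, hη, h⟩ := hXs (δ / 2) (by positivity)
      refine ⟨η, hη, fun {ε} hε' hd' => ?_⟩
      rw [hζ0, dist_zero_right]
      rcases hε'.1.eq_or_lt with h1 | h1
      · rw [← h1, hζ0, norm_zero]; exact hδ
      · rw [hζp ε h1]
        rw [Real.dist_eq, sub_zero, abs_of_pos h1] at hd'
        have := boxMean_norm (X ε) (δ / 2) (h ε ⟨h1, hd'⟩)
        linarith
    · have hε' : ε ∈ Set.Ioo (0 : ℝ) ε₁ := ⟨h0, hε.2⟩
      refine ContinuousAt.continuousWithinAt ?_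
      rw [ContinuousAt, Metric.tendsto_nhds]
      intro δ hδ
      filter_upwards [hXc ε hε' (δ / 2) (by positivity), isOpen_Ioo.mem_nhds hε'] with ε' h h1
      rw [hζp ε h0, hζp ε' h1.1, dist_eq_norm, ← boxMean_sub _ _ (hXcont ε' h1) (hXcont ε hε')]
      have := boxMean_norm _ (δ / 2) h
      linarith
  · exact (hX ε hε).1.sub analyticOnNhd_const
  · intro ψ k
    simp only
    rw [(hX ε hε).2.1 ψ k]
  · rw [boxMean_sub (X ε) (fun _ => ζ ε) (hXcont ε hε) continuous_const, boxMean_const, hζp ε hε.1, sub_self]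
  · intro t
    obtain ⟨v, w, hvw⟩ := (hX ε hε).2.2 0
    simp only [hsum, hω']
    have d1 : (deriv fun s : ℝ => c + X ε (0 + s • ω)) = v := by
      ext1 s
      exact ((hvw s).1.const_add c).deriv
    rw [d1, (hvw t).2.1.deriv, (hvw t).2.2]
    rw [← smul_add]
    congr 1
    abel
  · simp only [hsum, add_sub_cancel_left]
    rw [Metric.tendsto_nhdsWithin_nhds]
    intro δ hδ
    obtain ⟨η, hη, h⟩ := hXs (δ / 2) (by positivity)
    refine ⟨η, hη, fun {ε} hε hd' => ?_⟩
    have hε0 : 0 < ε := hε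
    rw [Real.dist_eq, sub_zero, abs_of_pos hε0] at hd'
    rw [Real.dist_eq, sub_zero, abs_of_nonneg (Real.iSup_nonneg fun t => norm_nonneg _)]
    have : (⨆ t : ℝ, ‖X ε fun j => ω j * t‖) ≤ δ / 2 := ciSup_le fun t => h ε ⟨hε0, hd'⟩ _
    linarith

end
end

section
/- Let m, d ≥ 1, let ω ∈ ℝ^d satisfy ω·ν ≠ 0 for every nonzero ν ∈ ℤ^d, let Γ and A = Hess V(c) be symmetric positive definite real m×m matrices with g = ∇V for V real analytic, and let f : ℝ^d → ℝ^m be (2πℤ)^d-periodic real analytic with Fourier coefficients satisfying |f_ν| ≤ Φ e^{−ξ|ν|} for some Φ, ξ > 0 and with g(c) = f₀. Let G_p(c) denote the p-th Taylor tensor of g at c, so that g(x) = Σ_{p≥0} G_p(c)(x−c)^p, with componentwise bounds |[G_p(c)]_{i,i₁,…,i_p}| ≤ Δ ρ^{−p} for some Δ, ρ > 0. For parameters ε > 0 and ζ ∈ ℝ^m define recursively u^{(1)}_0 = ζ, u^{(k)}_0 = 0 for k ≥ 2, u^{(1)}_ν = ε D(ε, ω·ν)⁻¹ f_ν for ν ≠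 0, and for k ≥ 2 and ν ≠ 0, u^{(k)}_ν = −ε D(ε, ω·ν)⁻¹ Σ_{p≥2} Σ_{k₁+…+k_p = k−1, k_i ≥ 1} Σ_{ν₁+…+ν_p = ν} G_p(c)(u^{(k₁)}_{ν₁}, …, u^{(k_p)}_{ν_p}), where D(ε, s) = −ε s² I + i s Γ + ε A. Then for every η ∈ (0,1) there exist ε̄ > 0, ζ̄ > 0 and B₀ > 0 such that for all 0 < ε < ε̄ and |ζ| < ζ̄ the defining sums converge absolutely and for all k ≥ 1 and all nonzero ν ∈ ℤ^d one has |u^{(k)}_ν| ≤ B₀ η^k e^{−ξ |ν|/2}. -/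
open scoped Real Classical

noncomputable section

/-- The `ν`-th Fourier coefficient of a `(2πℤ)^d`-periodic function `F : ℝ^d → ℂ^m`. -/
def fourierCoeffBox (d m : ℕ) (F : (Fin d → ℝ) → (Fin m → ℂ)) (ν : Fin d → ℤ) :
    Fin m → ℂ :=
  ((2 * π)⁻¹ ^ d : ℝ) •
    ∫ ψ in Set.univ.pi fun _ : Fin d => Set.Icc (0 : ℝ) (2 * π),
      Complex.exp (-Complex.I * ∑ j, (ν j : ℂ) * (ψ j : ℂ)) • F ψ

/-- The propagator matrix `D(ε,s) = -ε s² 1 + i s Γ + ε A`. -/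
def propagator (m : ℕ) (Γ A : Matrix (Fin m) (Fin m) ℝ) (ε s : ℝ) :
    Matrix (Fin m) (Fin m) ℂ :=
  (-(ε * s ^ 2) : ℂ) • (1 : Matrix (Fin m) (Fin m) ℂ)
    + (Complex.I * s) • Γ.map (fun a => (a : ℂ))
    + (ε : ℂ) • A.map (fun a => (a : ℂ))

/-- The components `[G_p(c)]_{i, j₁, …, j_p}` of the `p`-th Taylor tensor of `g` at `c`. -/
def taylorTensor (m : ℕ) (g : (Fin m → ℝ) → (Fin m → ℝ)) (c : Fin m → ℝ)
    (p : ℕ) (i : Fin m) (js : Fin p → Fin m) : ℝ :=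
  (p.factorial : ℝ)⁻¹ * iteratedFDeriv ℝ p (fun x => g x i) c (fun l => Pi.single (js l) 1)

/-- A single term of the sum appearing in the recursion for `u^{(k)}_ν`: the index `x`
collects `p ≥ 2`, orders `k₁, …, k_p ≥ 1` with `k₁ + ⋯ + k_p = k - 1` and modes
`ν₁, …, ν_p` with `ν₁ + ⋯ + ν_p = ν`; the term is the multilinear action of the Taylor
tensor `G_p` on `u^{(k₁)}_{ν₁}, …, u^{(k_p)}_{ν_p}`. -/
def recTerm (d m : ℕ) (G : (p : ℕ) → Fin m → (Fin p → Fin m) → ℝ)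
    (u : ℕ → (Fin d → ℤ) → (Fin m → ℂ)) (k : ℕ) (ν : Fin d → ℤ)
    (x : Σ p : ℕ, (Fin p → ℕ) × (Fin p → Fin d → ℤ)) : Fin m → ℂ :=
  if 2 ≤ x.1 ∧ (∀ l, 1 ≤ x.2.1 l) ∧ (∑ l, x.2.1 l) = k - 1 ∧ (∑ l, x.2.2 l) = ν then
    fun i => ∑ js : Fin x.1 → Fin m,
      ((G x.1 i js : ℝ) : ℂ) * ∏ l, u (x.2.1 l) (x.2.2 l) (js l)
  else 0

lemma rcb_tsum_pi {ι : Type*} (a : ι → ENNReal) (n : ℕ) :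
    ∑' x : Fin n → ι, ∏ l, a (x l) = (∑' i, a i) ^ n := by
  induction n with
  | zero => simp
  | succ n ih =>
    rw [← (Fin.consEquiv (fun _ : Fin (n+1) => ι)).tsum_eq]
    rw [ENNReal.tsum_prod']
    simp only [Fin.consEquiv_apply, Fin.prod_univ_succ, Fin.cons_zero, Fin.cons_succ]
    simp only [ENNReal.tsum_mul_left, ENNReal.tsum_mul_right]
    rw [ih, pow_succ, mul_comm]

/-- Recursive construction of the coefficients. -/
def rcbU (d m : ℕ) (G : (p : ℕ) → Fin m → (Fin p → Fin m) → ℝ)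
    (M : (Fin d → ℤ) → (Fin m → ℂ) → (Fin m → ℂ)) (z : Fin m → ℂ)
    (F : (Fin d → ℤ) → (Fin m → ℂ)) (k : ℕ) (ν : Fin d → ℤ) : Fin m → ℂ :=
  if ν = 0 then (if k = 1 then z else 0) else
    if k = 1 then F ν else
      M ν (∑' x : Σ p : ℕ, (Fin p → ℕ) × (Fin p → Fin d → ℤ),
        recTerm d m G (fun k' ν' => if _h : k' < k then rcbU d m G M z F k' ν' else 0) k ν x)
termination_by k

lemma rcb_recTerm_congr (d m : ℕ) (G : (p : ℕ) → Fin m → (Fin p → Fin m) → ℝ)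
    (u v : ℕ → (Fin d → ℤ) → (Fin m → ℂ)) (k : ℕ) (hk : 2 ≤ k) (ν : Fin d → ℤ)
    (h : ∀ k' < k, v k' = u k')
    (x : Σ p : ℕ, (Fin p → ℕ) × (Fin p → Fin d → ℤ)) :
    recTerm d m G v k ν x = recTerm d m G u k ν x := by
  unfold recTerm
  split_ifs with hc
  · ext i
    refine Finset.sum_congr rfl fun js _ => ?_
    congr 1
    refine Finset.prod_congr rfl fun l _ => ?_
    rw [h]
    have := Finset.single_le_sum (f := x.2.1) (fun i _ => Nat.zero_le _) (Finset.mem_univ l)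
    have h3 := hc.2.2.1
    omega
  · rfl

lemma rcb_exists (d m : ℕ) (G : (p : ℕ) → Fin m → (Fin p → Fin m) → ℝ)
    (M : (Fin d → ℤ) → (Fin m → ℂ) → (Fin m → ℂ)) (z : Fin m → ℂ)
    (F : (Fin d → ℤ) → (Fin m → ℂ)) :
    ∃ u : ℕ → (Fin d → ℤ) → (Fin m → ℂ), u 1 0 = z ∧ (∀ k, 2 ≤ k → u k 0 = 0) ∧
      (∀ ν, ν ≠ 0 → u 1 ν = F ν) ∧
      (∀ k, 2 ≤ k → ∀ ν, ν ≠ 0 → u k ν =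
        M ν (∑' x : Σ p : ℕ, (Fin p → ℕ) × (Fin p → Fin d → ℤ), recTerm d m G u k ν x)) := by
  refine ⟨rcbU d m G M z F, ?_, ?_, ?_, ?_⟩
  · rw [rcbU]; simp
  · intro k hk
    rw [rcbU]
    have : k ≠ 1 := by omega
    simp [this]
  · intro ν hν
    rw [rcbU]; simp [hν]
  · intro k hk ν hν
    rw [rcbU]
    have : k ≠ 1 := by omega
    simp only [hν, this, if_false]
    congr 1
    refine tsum_congr fun x => ?_
    refine rcb_recTerm_congr d m G _ _ k hk ν ?_ x
    intro k' hk'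
    ext ν' i
    simp [hk']

lemma rcb_recTerm_bound (d m : ℕ) (G : (p : ℕ) → Fin m → (Fin p → Fin m) → ℝ)
    (Δ ρ : ℝ) (hΔ : 0 < Δ) (hρ : 0 < ρ) (hG : ∀ p i js, |G p i js| ≤ Δ / ρ ^ p)
    (u : ℕ → (Fin d → ℤ) → (Fin m → ℂ)) (k : ℕ) (ν : Fin d → ℤ)
    (x : Σ p : ℕ, (Fin p → ℕ) × (Fin p → Fin d → ℤ)) :
    ‖recTerm d m G u k ν x‖ₑ ≤
      ENNReal.ofReal (Δ * (m / ρ) ^ x.1) * ∏ l, ‖u (x.2.1 l) (x.2.2 l)‖ₑ := by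
  have key : ‖recTerm d m G u k ν x‖ ≤ (Δ * (m / ρ) ^ x.1) * ∏ l, ‖u (x.2.1 l) (x.2.2 l)‖ := by
    have hnn : 0 ≤ (Δ * (m / ρ) ^ x.1) * ∏ l, ‖u (x.2.1 l) (x.2.2 l)‖ := by positivity
    unfold recTerm
    split_ifs with hc
    · rw [pi_norm_le_iff_of_nonneg hnn]
      intro i
      calc ‖∑ js : Fin x.1 → Fin m, ((G x.1 i js : ℝ) : ℂ) * ∏ l, u (x.2.1 l) (x.2.2 l) (js l)‖
          ≤ ∑ js : Fin x.1 → Fin m, (Δ / ρ ^ x.1) * ∏ l, ‖u (x.2.1 l) (x.2.2 l)‖ := by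
            refine norm_sum_le_of_le _ fun js _ => ?_
            rw [norm_mul, norm_prod]
            have h1 : ‖((G x.1 i js : ℝ) : ℂ)‖ ≤ Δ / ρ ^ x.1 := by
              simpa using hG x.1 i js
            refine mul_le_mul h1 ?_ (by positivity) (by positivity)
            exact Finset.prod_le_prod (fun _ _ => norm_nonneg _) fun l _ => norm_le_pi_norm _ _
        _ = _ := by
            simp only [Finset.sum_const, Finset.card_univ, Fintype.card_pi, Fintype.card_fin,
              Finset.prod_const, nsmul_eq_mul]
            push_cast
            rw [div_pow]; ring
    · simpa using hnn
  rw [← ofReal_norm]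
  refine (ENNReal.ofReal_le_ofReal key).trans_eq ?_
  rw [ENNReal.ofReal_mul (by positivity), ENNReal.ofReal_prod_of_nonneg (fun _ _ => norm_nonneg _)]
  simp [ofReal_norm]

/-- Exponential weight. -/
def rcbE (d : ℕ) (κ : ℝ) (ν : Fin d → ℤ) : ENNReal :=
  ENNReal.ofReal (Real.exp (κ * ∑ j, |(ν j : ℝ)|))

lemma rcbE_sum_le (d : ℕ) (κ : ℝ) (hκ : 0 ≤ κ) (p : ℕ) (ν : Fin p → Fin d → ℤ) :
    rcbE d κ (∑ l, ν l) ≤ ∏ l, rcbE d κ (ν l) := by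
  unfold rcbE
  rw [← ENNReal.ofReal_prod_of_nonneg (fun _ _ => (Real.exp_pos _).le), ← Real.exp_sum]
  refine ENNReal.ofReal_le_ofReal (Real.exp_le_exp.2 ?_)
  rw [← Finset.mul_sum, Finset.sum_comm]
  refine mul_le_mul_of_nonneg_left (Finset.sum_le_sum fun j _ => ?_) hκ
  rw [Finset.sum_apply]; push_cast
  exact Finset.abs_sum_le_sum_abs _ _

/-- Truncated weighted norm of coefficients. -/
def rcbA (d m : ℕ) (κ : ℝ) (μ : ENNReal) (u : ℕ → (Fin d → ℤ) → (Fin m → ℂ)) (K : ℕ)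
    (y : ℕ × (Fin d → ℤ)) : ENNReal :=
  if 1 ≤ y.1 ∧ y.1 ≤ K then ‖u y.1 y.2‖ₑ * rcbE d κ y.2 * μ ^ y.1 else 0

lemma rcb_sum_rec (d m : ℕ) (G : (p : ℕ) → Fin m → (Fin p → Fin m) → ℝ)
    (Δ ρ : ℝ) (hΔ : 0 < Δ) (hρ : 0 < ρ) (hG : ∀ p i js, |G p i js| ≤ Δ / ρ ^ p)
    (u : ℕ → (Fin d → ℤ) → (Fin m → ℂ)) (κ : ℝ) (hκ : 0 ≤ κ) (μ : ENNReal) (K : ℕ) :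
    ∑' y : ℕ × (Fin d → ℤ), (if 2 ≤ y.1 ∧ y.1 ≤ K + 1 then
      (∑' x, ‖recTerm d m G u y.1 y.2 x‖ₑ) * rcbE d κ y.2 * μ ^ (y.1 - 1) else 0) ≤
    ∑' p : ℕ, if 2 ≤ p then
      ENNReal.ofReal (Δ * (m / ρ) ^ p) * (∑' y, rcbA d m κ μ u K y) ^ p else 0 := by
  have hx : ∀ x : Σ p : ℕ, (Fin p → ℕ) × (Fin p → Fin d → ℤ),
      ∑' y : ℕ × (Fin d → ℤ), (if 2 ≤ y.1 ∧ y.1 ≤ K + 1 then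
        ‖recTerm d m G u y.1 y.2 x‖ₑ * rcbE d κ y.2 * μ ^ (y.1 - 1) else 0) ≤
      if 2 ≤ x.1 then ENNReal.ofReal (Δ * (m / ρ) ^ x.1) *
        ∏ l, rcbA d m κ μ u K (x.2.1 l, x.2.2 l) else 0 := by
    intro x
    rw [tsum_eq_single (∑ l, x.2.1 l + 1, ∑ l, x.2.2 l)]
    · split_ifs with h1 h2 h2
      · by_cases hl : ∀ l, 1 ≤ x.2.1 l
        · have hA : ∀ l, rcbA d m κ μ u K (x.2.1 l, x.2.2 l) =
              ‖u (x.2.1 l) (x.2.2 l)‖ₑ * rcbE d κ (x.2.2 l) * μ ^ (x.2.1 l) := by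
            intro l
            have := Finset.single_le_sum (f := x.2.1) (fun i _ => Nat.zero_le _) (Finset.mem_univ l)
            unfold rcbA
            rw [if_pos]
            exact ⟨hl l, by have := h1.2; simp only at this ⊢; omega⟩
          simp only [hA, Finset.prod_mul_distrib, ← mul_assoc]
          gcongr
          · exact rcb_recTerm_bound d m G Δ ρ hΔ hρ hG u _ _ x
          · exact rcbE_sum_le d κ hκ _ _
          · rw [Finset.prod_pow_eq_pow_sum]; simp
        · have : recTerm d m G u (∑ l, x.2.1 l + 1) (∑ l, x.2.2 l) x = 0 := by
            unfold recTerm; rw [if_neg]; tauto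
          rw [this]; simp
      · have : recTerm d m G u (∑ l, x.2.1 l + 1) (∑ l, x.2.2 l) x = 0 := by
          unfold recTerm; rw [if_neg]; tauto
        rw [this]; simp
      · exact zero_le
      · exact le_rfl
    · intro y hy
      split_ifs with h1
      · have : recTerm d m G u y.1 y.2 x = 0 := by
          unfold recTerm; rw [if_neg]
          rintro ⟨-, -, h3, h4⟩
          apply hy
          ext1
          · simp only; omega
          · exact h4.symm
        rw [this]; simp
      · rfl
  have e1 : ∀ y : ℕ × (Fin d → ℤ), (if 2 ≤ y.1 ∧ y.1 ≤ K + 1 then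
      (∑' x, ‖recTerm d m G u y.1 y.2 x‖ₑ) * rcbE d κ y.2 * μ ^ (y.1 - 1) else 0) =
      ∑' x, (if 2 ≤ y.1 ∧ y.1 ≤ K + 1 then
        ‖recTerm d m G u y.1 y.2 x‖ₑ * rcbE d κ y.2 * μ ^ (y.1 - 1) else 0) := by
    intro y
    split_ifs
    · rw [ENNReal.tsum_mul_right, ENNReal.tsum_mul_right]
    · simp
  simp only [e1]
  rw [ENNReal.tsum_comm]
  refine (ENNReal.tsum_le_tsum hx).trans_eq ?_
  rw [ENNReal.tsum_sigma']
  refine tsum_congr fun p => ?_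
  simp only
  split_ifs
  · rw [ENNReal.tsum_mul_left, ← rcb_tsum_pi]
    congr 1
    rw [← (Equiv.arrowProdEquivProdArrow (Fin p) (fun _ => ℕ) (fun _ => Fin d → ℤ)).tsum_eq]
    rfl
  · simp

lemma rcb_core (d m : ℕ) (G : (p : ℕ) → Fin m → (Fin p → Fin m) → ℝ)
    (Δ ρ : ℝ) (hΔ : 0 < Δ) (hρ : 0 < ρ) (hG : ∀ p i js, |G p i js| ≤ Δ / ρ ^ p)
    (u : ℕ → (Fin d → ℤ) → (Fin m → ℂ)) (κ : ℝ) (hκ : 0 ≤ κ) (μ : ENNReal)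
    (M : (Fin d → ℤ) → (Fin m → ℂ) → (Fin m → ℂ)) (C δ R : ENNReal)
    (hM : ∀ ν v, ν ≠ 0 → ‖M ν v‖ₑ ≤ C * ‖v‖ₑ)
    (h0 : ∀ k, 2 ≤ k → u k 0 = 0)
    (h1 : ∑' ν, ‖u 1 ν‖ₑ * rcbE d κ ν ≤ δ)
    (hu : ∀ k, 2 ≤ k → ∀ ν, ν ≠ 0 → u k ν =
        M ν (∑' x : Σ p : ℕ, (Fin p → ℕ) × (Fin p → Fin d → ℤ), recTerm d m G u k ν x))
    (hR : δ * μ + C * μ * (∑' p : ℕ, if 2 ≤ p then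
      ENNReal.ofReal (Δ * (m / ρ) ^ p) * R ^ p else 0) ≤ R) (K : ℕ) :
    ∑' y, rcbA d m κ μ u K y ≤ R := by
  induction K with
  | zero =>
    have : ∀ y, rcbA d m κ μ u 0 y = 0 := by
      intro y; unfold rcbA; rw [if_neg]; omega
    simp [this]
  | succ K ih =>
    have hle : ∀ y, rcbA d m κ μ u (K+1) y ≤
        (if y.1 = 1 then ‖u 1 y.2‖ₑ * rcbE d κ y.2 * μ else 0) +
        C * μ * (if 2 ≤ y.1 ∧ y.1 ≤ K + 1 then
      (∑' x, ‖recTerm d m G u y.1 y.2 x‖ₑ) * rcbE d κ y.2 * μ ^ (y.1 - 1) else 0) := by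
      rintro ⟨k, ν⟩
      unfold rcbA
      simp only
      by_cases hk1 : k = 1
      · subst hk1; simp
      by_cases hk : 2 ≤ k ∧ k ≤ K + 1
      · rw [if_pos ⟨by omega, hk.2⟩, if_neg hk1, if_pos hk, zero_add]
        by_cases hν : ν = 0
        · subst hν; rw [h0 k hk.1]; simp
        · obtain ⟨n, rfl⟩ : ∃ n, k = n + 1 := ⟨k - 1, by omega⟩
          calc ‖u (n+1) ν‖ₑ * rcbE d κ ν * μ ^ (n+1)
              ≤ (C * ∑' x, ‖recTerm d m G u (n+1) ν x‖ₑ) * rcbE d κ ν * μ ^ (n+1) := by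
                gcongr
                rw [hu _ hk.1 ν hν]
                refine (hM ν _ hν).trans ?_
                gcongr
                exact enorm_tsum_le_tsum_enorm
            _ = _ := by rw [Nat.add_sub_cancel, pow_succ]; ring
      · rw [if_neg (by omega)]; exact zero_le
    refine (ENNReal.tsum_le_tsum hle).trans ?_
    rw [ENNReal.tsum_add, ENNReal.tsum_mul_left]
    refine le_trans ?_ hR
    gcongr
    · rw [ENNReal.tsum_prod', tsum_eq_single 1]
      · simp only [if_true]
        rw [ENNReal.tsum_mul_right]; gcongr
      · intro k hk; simp [hk]
    · refine (rcb_sum_rec d m G Δ ρ hΔ hρ hG u κ hκ μ K).trans ?_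
      refine ENNReal.tsum_le_tsum fun p => ?_
      split_ifs
      · gcongr
      · exact le_rfl

lemma rcb_posdef (m : ℕ) (hm : 1 ≤ m) (Q : Matrix (Fin m) (Fin m) ℝ) (hQ : Q.PosDef) :
    ∃ γ > (0:ℝ), ∀ x : Fin m → ℝ, γ * ∑ i, x i ^ 2 ≤ x ⬝ᵥ (Q.mulVec x) := by
  have : Nonempty (Fin m) := ⟨⟨0, hm⟩⟩
  have hc : IsCompact (Metric.sphere (0 : Fin m → ℝ) 1) := isCompact_sphere _ _
  have hne : (Metric.sphere (0 : Fin m → ℝ) 1).Nonempty := NormedSpace.sphere_nonempty.2 zero_le_one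
  have hcont : Continuous fun x : Fin m → ℝ => x ⬝ᵥ (Q.mulVec x) := by
    fun_prop
  obtain ⟨x0, hx0, hmin⟩ := hc.exists_isMinOn hne hcont.continuousOn
  have hx0' : x0 ≠ 0 := by rintro rfl; simp at hx0
  have hpos : 0 < x0 ⬝ᵥ (Q.mulVec x0) := by
    have := hQ.dotProduct_mulVec_pos hx0'
    simpa using this
  set t := x0 ⬝ᵥ (Q.mulVec x0) with ht
  have hmpos : (0:ℝ) < m := by exact_mod_cast hm
  refine ⟨t / m, by positivity, fun x => ?_⟩
  have h2 : t * ‖x‖ ^ 2 ≤ x ⬝ᵥ (Q.mulVec x) := by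
    by_cases hx : x = 0
    · subst hx; simp
    have hn : 0 < ‖x‖ := norm_pos_iff.2 hx
    have hs : (‖x‖⁻¹ • x) ∈ Metric.sphere (0 : Fin m → ℝ) 1 := by
      simp [norm_smul, hn.ne']
    have h := hmin hs
    simp only [Set.mem_ofPred_eq, Matrix.mulVec_smul, dotProduct_smul, smul_dotProduct,
      smul_eq_mul] at h
    rw [← ht] at h
    have e : ‖x‖⁻¹ * (‖x‖⁻¹ * (x ⬝ᵥ (Q.mulVec x))) = (x ⬝ᵥ (Q.mulVec x)) / ‖x‖ ^ 2 := by
      field_simp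
    rw [e, le_div_iff₀ (by positivity)] at h
    exact h
  refine le_trans ?_ h2
  have h3 : ∑ i, x i ^ 2 ≤ m * ‖x‖ ^ 2 := by
    calc ∑ i, x i ^ 2 ≤ ∑ _i : Fin m, ‖x‖ ^ 2 := by
          refine Finset.sum_le_sum fun i _ => ?_
          rw [← sq_abs]
          have := norm_le_pi_norm x i
          rw [Real.norm_eq_abs] at this
          gcongr
      _ = _ := by simp
  calc t / m * ∑ i, x i ^ 2 ≤ t / m * (m * ‖x‖ ^ 2) := by gcongr
    _ = _ := by field_simp

lemma rcb_quad (m : ℕ) (Q : Matrix (Fin m) (Fin m) ℝ) (hQ : Q.IsSymm) (x : Fin m → ℂ) :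
    star x ⬝ᵥ ((Q.map (fun a => (a : ℂ))).mulVec x) =
      (((fun i => (x i).re) ⬝ᵥ Q.mulVec (fun i => (x i).re) +
        (fun i => (x i).im) ⬝ᵥ Q.mulVec (fun i => (x i).im) : ℝ) : ℂ) := by
  have hs : (fun i => (x i).re) ⬝ᵥ Q.mulVec (fun i => (x i).im) =
      (fun i => (x i).im) ⬝ᵥ Q.mulVec (fun i => (x i).re) := by
    rw [Matrix.dotProduct_mulVec, ← Matrix.mulVec_transpose, hQ.eq, dotProduct_comm]
  simp only [dotProduct, Matrix.mulVec, Finset.mul_sum] at hs ⊢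
  apply Complex.ext
  · simp [← Finset.sum_add_distrib]
  · simp [Finset.sum_add_distrib] at hs ⊢
    linarith

lemma rcb_resolvent (m : ℕ) (hm : 1 ≤ m) (Γ A : Matrix (Fin m) (Fin m) ℝ)
    (hΓs : Γ.IsSymm) (hΓ : Γ.PosDef) (hAs : A.IsSymm) (hA : A.PosDef) :
    ∃ C > (0:ℝ), ∃ C₁ > (0:ℝ), ∀ ε s : ℝ, 0 < ε → ε < 1 → s ≠ 0 → ∀ v : Fin m → ℂ,
      ‖(ε : ℂ) • (propagator m Γ A ε s)⁻¹.mulVec v‖ ≤ C * ‖v‖ ∧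
      ‖(ε : ℂ) • (propagator m Γ A ε s)⁻¹.mulVec v‖ ≤ (ε * C₁ / |s|) * ‖v‖ := by
  obtain ⟨γ, hγ, hγQ⟩ := rcb_posdef m hm Γ hΓ
  obtain ⟨a, ha, haQ⟩ := rcb_posdef m hm A hA
  have hmpos : (0:ℝ) < m := by exact_mod_cast hm
  refine ⟨2 * m / a + m / γ / Real.sqrt (a / 2), by positivity, m / γ, by positivity, ?_⟩
  intro ε s hε hε1 hs v
  have hspos : 0 < |s| := abs_pos.2 hs
  by_cases hD : IsUnit (propagator m Γ A ε s).det
  swap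
  · rw [Matrix.nonsing_inv_apply_not_isUnit _ hD]
    simp only [Matrix.zero_mulVec, smul_zero, norm_zero]
    constructor <;> positivity
  set x := (propagator m Γ A ε s)⁻¹.mulVec v with hx
  have hDx : (propagator m Γ A ε s).mulVec x = v := by
    rw [hx, Matrix.mulVec_mulVec, Matrix.mul_nonsing_inv _ hD, Matrix.one_mulVec]
  obtain ⟨qΓ, hqΓ⟩ : ∃ q : ℝ, q = (fun i => (x i).re) ⬝ᵥ Γ.mulVec (fun i => (x i).re) +
        (fun i => (x i).im) ⬝ᵥ Γ.mulVec (fun i => (x i).im) := ⟨_, rfl⟩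
  obtain ⟨qA, hqA⟩ : ∃ q : ℝ, q = (fun i => (x i).re) ⬝ᵥ A.mulVec (fun i => (x i).re) +
        (fun i => (x i).im) ⬝ᵥ A.mulVec (fun i => (x i).im) := ⟨_, rfl⟩
  set N : ℝ := ∑ i, ((x i).re ^ 2 + (x i).im ^ 2) with hN
  have hNΓ : γ * N ≤ qΓ := by
    rw [hqΓ, hN, Finset.sum_add_distrib, mul_add]
    exact add_le_add (hγQ _) (hγQ _)
  have hNA : a * N ≤ qA := by
    rw [hqA, hN, Finset.sum_add_distrib, mul_add]
    exact add_le_add (haQ _) (haQ _)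
  have hxx : star x ⬝ᵥ x = (N : ℂ) := by
    rw [hN, dotProduct]
    push_cast
    refine Finset.sum_congr rfl fun i _ => ?_
    apply Complex.ext
    · simp [← Complex.ofReal_pow]; ring
    · simp [← Complex.ofReal_pow]; ring
  have hmain : star x ⬝ᵥ v = ((-(ε * s ^ 2) * N + ε * qA : ℝ) : ℂ) + ((s * qΓ : ℝ) : ℂ) * Complex.I := by
    rw [← hDx]
    unfold propagator
    rw [Matrix.add_mulVec, Matrix.add_mulVec, dotProduct_add, dotProduct_add,
      Matrix.smul_mulVec, Matrix.smul_mulVec, Matrix.smul_mulVec, dotProduct_smul,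
      dotProduct_smul, dotProduct_smul, rcb_quad m Γ hΓs, rcb_quad m A hAs, Matrix.one_mulVec,
      hxx, ← hqΓ, ← hqA]
    simp only [smul_eq_mul]
    push_cast
    ring
  have hNx : ‖x‖ ^ 2 ≤ N := by
    have hN0 : 0 ≤ N := Finset.sum_nonneg fun i _ => by positivity
    have : ‖x‖ ≤ Real.sqrt N := by
      rw [pi_norm_le_iff_of_nonneg (Real.sqrt_nonneg _)]
      intro i
      apply Real.le_sqrt_of_sq_le
      rw [← Complex.normSq_eq_norm_sq, Complex.normSq_apply, ← sq, ← sq]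
      exact Finset.single_le_sum (f := fun i => (x i).re ^ 2 + (x i).im ^ 2)
        (fun i _ => by positivity) (Finset.mem_univ i)
    calc ‖x‖ ^ 2 ≤ Real.sqrt N ^ 2 := by gcongr
      _ = N := Real.sq_sqrt hN0
  have hup : ‖star x ⬝ᵥ v‖ ≤ m * ‖x‖ * ‖v‖ := by
    rw [dotProduct]
    refine (norm_sum_le _ _).trans ?_
    calc ∑ i, ‖star x i * v i‖ ≤ ∑ _i : Fin m, ‖x‖ * ‖v‖ := by
          refine Finset.sum_le_sum fun i _ => ?_
          rw [norm_mul, Pi.star_apply, norm_star]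
          gcongr
          · exact norm_le_pi_norm x i
          · exact norm_le_pi_norm v i
      _ = _ := by simp; ring
  have hre : -(ε * s ^ 2) * N + ε * qA ≤ m * ‖x‖ * ‖v‖ := by
    refine le_trans ?_ ((Complex.re_le_norm _).trans hup)
    have key : ∀ r t : ℝ, ((r : ℂ) + (t : ℂ) * Complex.I).re = r := by intros; simp
    rw [hmain, key]
  have him : |s| * qΓ ≤ m * ‖x‖ * ‖v‖ := by
    refine le_trans ?_ ((Complex.abs_im_le_norm _).trans hup)
    have key : ∀ r t : ℝ, ((r : ℂ) + (t : ℂ) * Complex.I).im = t := by intros; simp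
    rw [hmain, key, abs_mul]
    gcongr; exact le_abs_self _
  have hsm : ‖(ε : ℂ) • x‖ = ε * ‖x‖ := by
    rw [norm_smul, Complex.norm_real, Real.norm_of_nonneg hε.le]
  rw [hsm]
  rcases eq_or_lt_of_le (norm_nonneg x) with h0 | hxpos
  · rw [← h0, mul_zero]
    constructor <;> positivity
  have hB : ‖x‖ ≤ m / γ / |s| * ‖v‖ := by
    have h1 : (|s| * γ * ‖x‖) * ‖x‖ ≤ (m * ‖v‖) * ‖x‖ := by
      calc (|s| * γ * ‖x‖) * ‖x‖ = |s| * (γ * ‖x‖ ^ 2) := by ring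
        _ ≤ |s| * (γ * N) := by gcongr
        _ ≤ |s| * qΓ := by gcongr
        _ ≤ _ := him
        _ = _ := by ring
    have h2 := le_of_mul_le_mul_right h1 hxpos
    rw [div_div, div_mul_eq_mul_div, le_div_iff₀ (by positivity)]
    linarith
  refine ⟨?_, ?_⟩
  · by_cases hcs : s ^ 2 ≤ a / 2
    · have h1 : (ε * (a / 2) * ‖x‖) * ‖x‖ ≤ (m * ‖v‖) * ‖x‖ := by
        calc (ε * (a / 2) * ‖x‖) * ‖x‖ = ε * (a / 2) * ‖x‖ ^ 2 := by ring
          _ ≤ ε * (a / 2) * N := by gcongr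
          _ ≤ ε * (a - s ^ 2) * N := by
              have hN0 : 0 ≤ N := le_trans (by positivity) hNx
              gcongr; linarith
          _ = -(ε * s ^ 2) * N + ε * (a * N) := by ring
          _ ≤ -(ε * s ^ 2) * N + ε * qA := by gcongr
          _ ≤ _ := hre
          _ = _ := by ring
      have h2 := le_of_mul_le_mul_right h1 hxpos
      have h3 : ε * ‖x‖ ≤ 2 * m / a * ‖v‖ := by
        rw [div_mul_eq_mul_div, le_div_iff₀ ha]; linarith
      refine h3.trans ?_
      gcongr
      exact le_add_of_nonneg_right (by positivity)
    · have hsq : Real.sqrt (a / 2) ≤ |s| := by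
        rw [← Real.sqrt_sq_eq_abs]; exact Real.sqrt_le_sqrt (not_le.1 hcs).le
      calc ε * ‖x‖ ≤ 1 * (m / γ / |s| * ‖v‖) := by gcongr
        _ = m / γ / |s| * ‖v‖ := one_mul _
        _ ≤ m / γ / Real.sqrt (a / 2) * ‖v‖ := by gcongr
        _ ≤ _ := by
          gcongr
          exact le_add_of_nonneg_left (by positivity)
  · calc ε * ‖x‖ ≤ ε * (m / γ / |s| * ‖v‖) := by gcongr
      _ = _ := by ring

lemma rcb_summable_exp (d : ℕ) (κ : ℝ) (hκ : 0 < κ) :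
    Summable fun ν : Fin d → ℤ => Real.exp (-κ * ∑ j, |(ν j : ℝ)|) := by
  have h1 : Summable fun n : ℤ => Real.exp (-κ * |(n : ℝ)|) := by
    have hn : Summable fun n : ℕ => Real.exp (-κ * n) := by
      have := summable_geometric_of_lt_one (Real.exp_pos (-κ)).le (Real.exp_lt_one_iff.2 (by linarith))
      refine this.congr fun n => ?_
      rw [← Real.exp_nat_mul]; ring_nf
    refine Summable.of_nat_of_neg ?_ ?_ <;> simpa using hn
  have h2 : ∑' ν : Fin d → ℤ, ENNReal.ofReal (Real.exp (-κ * ∑ j, |(ν j : ℝ)|)) ≠ ⊤ := by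
    have : ∀ ν : Fin d → ℤ, ENNReal.ofReal (Real.exp (-κ * ∑ j, |(ν j : ℝ)|)) =
        ∏ j, ENNReal.ofReal (Real.exp (-κ * |(ν j : ℝ)|)) := by
      intro ν
      rw [← ENNReal.ofReal_prod_of_nonneg (fun _ _ => (Real.exp_pos _).le), ← Real.exp_sum,
        Finset.mul_sum]
    simp only [this]
    rw [rcb_tsum_pi (fun n : ℤ => ENNReal.ofReal (Real.exp (-κ * |(n : ℝ)|)))]
    exact ENNReal.pow_ne_top h1.tsum_ofReal_ne_top
  have h3 := ENNReal.summable_toReal h2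
  refine h3.congr fun ν => ?_
  rw [ENNReal.toReal_ofReal (Real.exp_pos _).le]

lemma rcb_small (d : ℕ) (κ : ℝ) (hκ : 0 < κ) (C C₁ Φ : ℝ) (hC : 0 < C) (hC₁ : 0 < C₁)
    (hΦ : 0 < Φ) (s : (Fin d → ℤ) → ℝ) (δ : ℝ) (hδ : 0 < δ) :
    ∃ ε₀ > (0:ℝ), ∀ ε, 0 < ε → ε < ε₀ →
      Summable (fun ν : Fin d → ℤ =>
        min C (ε * C₁ / |s ν|) * (Φ * Real.exp (-κ * ∑ j, |(ν j : ℝ)|))) ∧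
      ∑' ν : Fin d → ℤ,
        min C (ε * C₁ / |s ν|) * (Φ * Real.exp (-κ * ∑ j, |(ν j : ℝ)|)) ≤ δ := by
  have hs := ((rcb_summable_exp d κ hκ).mul_left Φ).mul_left C
  have hb : ∀ ε : ℝ, 0 < ε → ∀ ν : Fin d → ℤ,
      ‖min C (ε * C₁ / |s ν|) * (Φ * Real.exp (-κ * ∑ j, |(ν j : ℝ)|))‖ ≤
      C * (Φ * Real.exp (-κ * ∑ j, |(ν j : ℝ)|)) := by
    intro ε hε ν
    have h0 : 0 ≤ min C (ε * C₁ / |s ν|) := le_min hC.le (by positivity)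
    rw [Real.norm_of_nonneg (by positivity)]
    gcongr
    exact min_le_left _ _
  have ht : Filter.Tendsto (fun ε : ℝ => ∑' ν : Fin d → ℤ,
        min C (ε * C₁ / |s ν|) * (Φ * Real.exp (-κ * ∑ j, |(ν j : ℝ)|)))
      (nhdsWithin 0 (Set.Ioi 0)) (nhds (∑' _ν : Fin d → ℤ, (0:ℝ))) := by
    refine tendsto_tsum_of_dominated_convergence hs (fun ν => ?_) ?_
    · have hcont : Continuous fun ε : ℝ =>
          min C (ε * C₁ / |s ν|) * (Φ * Real.exp (-κ * ∑ j, |(ν j : ℝ)|)) := by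
        fun_prop
      have := (hcont.tendsto 0).mono_left (nhdsWithin_le_nhds (s := Set.Ioi 0))
      simpa [hC.le] using this
    · filter_upwards [self_mem_nhdsWithin] with ε hε ν
      exact hb ε hε ν
  rw [tsum_zero] at ht
  have hev := ht.eventually (gt_mem_nhds hδ)
  rw [eventually_nhdsWithin_iff, Metric.eventually_nhds_iff] at hev
  obtain ⟨ε₀, h0, h⟩ := hev
  refine ⟨ε₀, h0, fun ε hε hlt => ⟨Summable.of_norm_bounded hs (hb ε hε), (h ?_ hε).le⟩⟩
  simpa [abs_of_pos hε] using hlt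

lemma rcb_geom (Δ b R : ℝ) (hΔ : 0 < Δ) (hb : 0 < b) (hR : 0 < R) (h : b * R ≤ 1 / 2) :
    (∑' p : ℕ, if 2 ≤ p then
      ENNReal.ofReal (Δ * b ^ p) * ENNReal.ofReal R ^ p else 0) ≤
      ENNReal.ofReal (2 * Δ * b ^ 2 * R ^ 2) := by
  rw [tsum_eq_zero_add' ENNReal.summable, tsum_eq_zero_add' ENNReal.summable]
  have e : ∀ n : ℕ, (if 2 ≤ n + 1 + 1 then
      ENNReal.ofReal (Δ * b ^ (n+1+1)) * ENNReal.ofReal R ^ (n+1+1) else 0) =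
      ENNReal.ofReal (Δ * b ^ 2 * R ^ 2 * (b * R) ^ n) := by
    intro n
    rw [if_pos (by omega), ← ENNReal.ofReal_pow hR.le, ← ENNReal.ofReal_mul (by positivity)]
    congr 1; ring
  simp only [e]
  simp only [show ¬ (2 ≤ 0) by omega, show ¬ (2 ≤ 0 + 1) by omega, if_false, zero_add]
  have hbR : 0 < b * R := by positivity
  have hs := (summable_geometric_of_lt_one hbR.le (by linarith)).mul_left (Δ * b ^ 2 * R ^ 2)
  rw [← ENNReal.ofReal_tsum_of_nonneg (fun n => by positivity) hs]
  refine ENNReal.ofReal_le_ofReal ?_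
  rw [tsum_mul_left, tsum_geometric_of_lt_one hbR.le (by linarith)]
  have : (1 - b * R)⁻¹ ≤ 2 := by
    rw [inv_le_comm₀ (by linarith) (by norm_num)]; linarith
  calc Δ * b ^ 2 * R ^ 2 * (1 - b * R)⁻¹ ≤ Δ * b ^ 2 * R ^ 2 * 2 := by gcongr
    _ = _ := by ring

theorem recursive_coefficient_bounds
    (m d : ℕ) (hm : 1 ≤ m) (hd : 1 ≤ d)
    (ω : Fin d → ℝ) (hω : ∀ ν : Fin d → ℤ, ν ≠ 0 → (∑ j, ω j * ν j) ≠ 0)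
    (Γ : Matrix (Fin m) (Fin m) ℝ) (hΓsymm : Γ.IsSymm) (hΓpos : Γ.PosDef)
    (V : (Fin m → ℝ) → ℝ) (hV : AnalyticOnNhd ℝ V Set.univ)
    (g : (Fin m → ℝ) → (Fin m → ℝ))
    (hg : ∀ x i, g x i = fderiv ℝ V x (Pi.single i 1))
    (c : Fin m → ℝ)
    (A : Matrix (Fin m) (Fin m) ℝ) (hA : A = hessianMatrix m V c)
    (hApos : A.PosDef)
    (f : (Fin d → ℝ) → (Fin m → ℝ))
    (hfper : IsPeriodic2pi d m f) (hfan : AnalyticOnNhd ℝ f Set.univ)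
    (hc : g c = boxMean d m f)
    (Φ ξ : ℝ) (hΦ : 0 < Φ) (hξ : 0 < ξ)
    (hfν : ∀ ν : Fin d → ℤ,
      ‖fourierCoeffBox d m (fun ψ i => (f ψ i : ℂ)) ν‖
        ≤ Φ * Real.exp (-ξ * ∑ j, |(ν j : ℝ)|))
    (Δ ρ : ℝ) (hΔ : 0 < Δ) (hρ : 0 < ρ)
    (hG : ∀ (p : ℕ) (i : Fin m) (js : Fin p → Fin m),
      |taylorTensor m g c p i js| ≤ Δ / ρ ^ p) :
    ∀ η : ℝ, 0 < η → η < 1 →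
      ∃ εb > (0 : ℝ), ∃ ζb > (0 : ℝ), ∃ B₀ > (0 : ℝ),
        ∀ ε : ℝ, 0 < ε → ε < εb → ∀ ζ : Fin m → ℝ, ‖ζ‖ < ζb →
          ∃ u : ℕ → (Fin d → ℤ) → (Fin m → ℂ),
            -- initialisation of the recursion
            (u 1 0 = fun i => (ζ i : ℂ)) ∧
            (∀ k, 2 ≤ k → u k 0 = 0) ∧
            (∀ ν : Fin d → ℤ, ν ≠ 0 →
              u 1 ν = (ε : ℂ) •
                (propagator m Γ A ε (∑ j, ω j * ν j))⁻¹.mulVec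
                  (fourierCoeffBox d m (fun ψ i => (f ψ i : ℂ)) ν)) ∧
            -- the recursion step: its defining sums converge absolutely
            (∀ k, 2 ≤ k → ∀ ν : Fin d → ℤ, ν ≠ 0 →
              (Summable fun x : Σ p : ℕ, (Fin p → ℕ) × (Fin p → Fin d → ℤ) =>
                ‖recTerm d m (taylorTensor m g c) u k ν x‖) ∧
              u k ν = (-(ε : ℂ)) •
                (propagator m Γ A ε (∑ j, ω j * ν j))⁻¹.mulVec
                  (∑' x : Σ p : ℕ, (Fin p → ℕ) × (Fin p → Fin d → ℤ),
                    recTerm d m (taylorTensor m g c) u k ν x)) ∧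
            -- the exponential bounds on the coefficients
            (∀ k, 1 ≤ k → ∀ ν : Fin d → ℤ, ν ≠ 0 →
              ‖u k ν‖ ≤ B₀ * η ^ k * Real.exp (-ξ * (∑ j, |(ν j : ℝ)|) / 2)) := by
  intro η hη hη1
  have hAs : A.IsSymm := by
    have := hApos.isHermitian
    rwa [Matrix.IsHermitian, Matrix.conjTranspose_eq_transpose_of_trivial] at this
  obtain ⟨C, hC, C₁, hC₁, hres⟩ := rcb_resolvent m hm Γ A hΓsymm hΓpos hAs hApos
  have hmpos : (0:ℝ) < m := by exact_mod_cast hm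
  set b : ℝ := m / ρ with hb
  have hbpos : 0 < b := by positivity
  set R : ℝ := min (1 / (2 * b)) (η / (4 * C * Δ * b ^ 2)) with hR
  have hRpos : 0 < R := lt_min (by positivity) (by positivity)
  have hR1 : b * R ≤ 1 / 2 := by
    have : R ≤ 1 / (2 * b) := min_le_left _ _
    rw [le_div_iff₀ (by positivity)] at this
    linarith
  have hR2 : C * η⁻¹ * (2 * Δ * b ^ 2 * R ^ 2) ≤ R / 2 := by
    have : R ≤ η / (4 * C * Δ * b ^ 2) := min_le_right _ _
    rw [le_div_iff₀ (by positivity)] at this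
    have h2 : C * η⁻¹ * (2 * Δ * b ^ 2 * R ^ 2) = (R * (4 * C * Δ * b ^ 2)) * (R / 2) * η⁻¹ := by
      ring
    rw [h2]
    calc (R * (4 * C * Δ * b ^ 2)) * (R / 2) * η⁻¹ ≤ η * (R / 2) * η⁻¹ := by gcongr
      _ = R / 2 := by field_simp
  have hκ : 0 < ξ / 2 := by positivity
  obtain ⟨ε₀, hε₀, hsmall⟩ := rcb_small d (ξ / 2) hκ C C₁ Φ hC hC₁ hΦ
    (fun ν => ∑ j, ω j * ν j) (R * η / 4) (by positivity)
  refine ⟨min 1 ε₀, lt_min one_pos hε₀, R * η / 4, by positivity, R, hRpos, ?_⟩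
  intro ε hε hεlt ζ hζ
  have hε1 : ε < 1 := hεlt.trans_le (min_le_left _ _)
  obtain ⟨hsum, hle⟩ := hsmall ε hε (hεlt.trans_le (min_le_right _ _))
  obtain ⟨u, hu0, huk0, hu1, hu⟩ := rcb_exists d m (taylorTensor m g c)
    (fun ν v => (-(ε : ℂ)) • (propagator m Γ A ε (∑ j, ω j * ν j))⁻¹.mulVec v)
    (fun i => (ζ i : ℂ))
    (fun ν => (ε : ℂ) • (propagator m Γ A ε (∑ j, ω j * ν j))⁻¹.mulVec
                  (fourierCoeffBox d m (fun ψ i => (f ψ i : ℂ)) ν))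
  have hM : ∀ (ν : Fin d → ℤ) (v : Fin m → ℂ), ν ≠ 0 →
      ‖(-(ε : ℂ)) • (propagator m Γ A ε (∑ j, ω j * ν j))⁻¹.mulVec v‖ₑ ≤
        ENNReal.ofReal C * ‖v‖ₑ := by
    intro ν v hν
    rw [neg_smul, enorm_neg, ← ofReal_norm, ← ofReal_norm, ← ENNReal.ofReal_mul hC.le]
    exact ENNReal.ofReal_le_ofReal (hres ε _ hε hε1 (hω ν hν) v).1
  have h1 : ∑' ν, ‖u 1 ν‖ₑ * rcbE d (ξ / 2) ν ≤ ENNReal.ofReal (R * η / 2) := by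
    have hterm : ∀ ν : Fin d → ℤ, ‖u 1 ν‖ₑ * rcbE d (ξ / 2) ν ≤
        (if ν = 0 then ENNReal.ofReal (R * η / 4) else 0) +
        ENNReal.ofReal (min C (ε * C₁ / |∑ j, ω j * ν j|) *
          (Φ * Real.exp (-(ξ / 2) * ∑ j, |(ν j : ℝ)|))) := by
      intro ν
      by_cases hν : ν = 0
      · subst hν
        rw [if_pos rfl, hu0]
        refine le_trans ?_ le_self_add
        have : rcbE d (ξ / 2) 0 = 1 := by simp [rcbE]
        rw [this, mul_one, ← ofReal_norm]
        refine ENNReal.ofReal_le_ofReal ?_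
        rw [pi_norm_le_iff_of_nonneg (by positivity)]
        intro i
        rw [Complex.norm_real]
        exact (norm_le_pi_norm ζ i).trans hζ.le
      · rw [if_neg hν, zero_add, rcbE, ← ofReal_norm, ← ENNReal.ofReal_mul (norm_nonneg _)]
        refine ENNReal.ofReal_le_ofReal ?_
        rw [hu1 ν hν]
        set F := fourierCoeffBox d m (fun ψ i => (f ψ i : ℂ)) ν
        obtain ⟨hr1, hr2⟩ := hres ε _ hε hε1 (hω ν hν) F
        set X := ‖(ε : ℂ) • (propagator m Γ A ε (∑ j, ω j * ν j))⁻¹.mulVec F‖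
        have hmin : X ≤ min C (ε * C₁ / |∑ j, ω j * ν j|) * ‖F‖ := by
          rw [min_mul_of_nonneg _ _ (norm_nonneg _)]
          exact le_min hr1 hr2
        have h0 : 0 ≤ min C (ε * C₁ / |∑ j, ω j * ν j|) := le_min hC.le (by positivity)
        calc X * Real.exp (ξ / 2 * ∑ j, |(ν j : ℝ)|)
            ≤ (min C (ε * C₁ / |∑ j, ω j * ν j|) *
              (Φ * Real.exp (-ξ * ∑ j, |(ν j : ℝ)|))) * Real.exp (ξ / 2 * ∑ j, |(ν j : ℝ)|) := by
              gcongr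
              refine hmin.trans ?_
              gcongr
              exact hfν ν
          _ = min C (ε * C₁ / |∑ j, ω j * ν j|) * (Φ *
              (Real.exp (-ξ * ∑ j, |(ν j : ℝ)|) * Real.exp (ξ / 2 * ∑ j, |(ν j : ℝ)|))) := by
              ring
          _ = _ := by
              rw [← Real.exp_add]
              congr 3
              ring
    refine (ENNReal.tsum_le_tsum hterm).trans ?_
    rw [ENNReal.tsum_add, tsum_ite_eq, ← ENNReal.ofReal_tsum_of_nonneg _ hsum,
      ← ENNReal.ofReal_add (by positivity)]
    · refine ENNReal.ofReal_le_ofReal ?_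
      linarith
    · refine tsum_nonneg fun ν => mul_nonneg (le_min hC.le (by positivity)) (by positivity)
    · exact fun ν => mul_nonneg (le_min hC.le (by positivity)) (by positivity)
  have hgeom := rcb_geom Δ b R hΔ hbpos hRpos hR1
  have hRR : ENNReal.ofReal (R * η / 2) * ENNReal.ofReal η⁻¹ +
      ENNReal.ofReal C * ENNReal.ofReal η⁻¹ * (∑' p : ℕ, if 2 ≤ p then
      ENNReal.ofReal (Δ * (m / ρ) ^ p) * ENNReal.ofReal R ^ p else 0) ≤ ENNReal.ofReal R := by
    calc _ ≤ ENNReal.ofReal (R * η / 2) * ENNReal.ofReal η⁻¹ +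
          ENNReal.ofReal C * ENNReal.ofReal η⁻¹ * ENNReal.ofReal (2 * Δ * b ^ 2 * R ^ 2) := by
          gcongr
      _ = ENNReal.ofReal (R * η / 2 * η⁻¹ + C * η⁻¹ * (2 * Δ * b ^ 2 * R ^ 2)) := by
          rw [ENNReal.ofReal_add (by positivity) (by positivity),
            ENNReal.ofReal_mul (p := R * η / 2) (by positivity),
            ENNReal.ofReal_mul (p := C * η⁻¹) (by positivity),
            ENNReal.ofReal_mul (p := C) hC.le]
      _ ≤ _ := by
          refine ENNReal.ofReal_le_ofReal ?_
          have : R * η / 2 * η⁻¹ = R / 2 := by field_simp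
          linarith
  have hcore := rcb_core d m (taylorTensor m g c) Δ ρ hΔ hρ hG u (ξ / 2) hκ.le
    (ENNReal.ofReal η⁻¹) _ _ _ _ hM huk0 h1 hu hRR
  refine ⟨u, hu0, huk0, hu1, fun k hk ν hν => ⟨?_, hu k hk ν hν⟩, fun k hk ν hν => ?_⟩
  · have hS := rcb_sum_rec d m (taylorTensor m g c) Δ ρ hΔ hρ hG u (ξ / 2) hκ.le
      (ENNReal.ofReal η⁻¹) k
    have hS2 := (ENNReal.le_tsum (k, ν)).trans hS
    simp only at hS2
    rw [if_pos ⟨hk, by omega⟩] at hS2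
    have hlt : (∑' p : ℕ, if 2 ≤ p then ENNReal.ofReal (Δ * (m / ρ) ^ p) *
        (∑' y, rcbA d m (ξ / 2) (ENNReal.ofReal η⁻¹) u k y) ^ p else 0) < ⊤ := by
      refine lt_of_le_of_lt ?_ (lt_of_le_of_lt hgeom ENNReal.ofReal_lt_top)
      refine ENNReal.tsum_le_tsum fun p => ?_
      split_ifs
      · gcongr
        exact hcore k
      · exact le_rfl
    have hfin := hS2.trans_lt hlt
    have hE : rcbE d (ξ / 2) ν ≠ 0 := by
      simp [rcbE, Real.exp_pos]
    have hμ : ENNReal.ofReal η⁻¹ ^ (k - 1) ≠ 0 := by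
      apply pow_ne_zero
      simpa using hη
    have hne : ∑' x, ‖recTerm d m (taylorTensor m g c) u k ν x‖ₑ ≠ ⊤ := by
      intro htop
      rw [htop, ENNReal.top_mul hE, ENNReal.top_mul hμ] at hfin
      exact lt_irrefl _ hfin
    refine (ENNReal.summable_toReal hne).congr fun x => ?_
    simp
  · have h := (ENNReal.le_tsum (k, ν)).trans (hcore k)
    rw [rcbA, if_pos ⟨hk, le_rfl⟩, rcbE, ← ofReal_norm, ← ENNReal.ofReal_mul (norm_nonneg _),
      ← ENNReal.ofReal_pow (by positivity), ← ENNReal.ofReal_mul (by positivity),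
      ENNReal.ofReal_le_ofReal_iff hRpos.le] at h
    simp only at h
    have e : Real.exp (-ξ * (∑ j, |(ν j : ℝ)|) / 2) = (Real.exp (ξ / 2 * ∑ j, |(ν j : ℝ)|))⁻¹ := by
      rw [← Real.exp_neg]; congr 1; ring
    rw [e, ← div_eq_mul_inv, le_div_iff₀ (Real.exp_pos _)]
    rwa [inv_pow, ← div_eq_mul_inv, div_le_iff₀ (by positivity)] at h

end
end
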